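/- arXiv:2604.13043 — 3 statements merged into one kernel-verified Lean document; each statement's English description precedes it below -/
import Mathlib

section
/- (Birkhoff–Kellogg type theorem in cones, Krasnosel'skii–Ladyzhenskii) Let (X,‖·‖) be a real Banach space, let C ⊂ X be a cone (a nonempty closed convex subset with μ·x ∈ C for all μ ≥ 0 and x ∈ C, and C ∩ (−C) = {0}), and let U ⊂ X be a bounded open set containing 0. Let T : C ∩ closure(U) → C be a compact operator (continuous with relatively compact image) such that inf{‖Tx‖ : x ∈ C ∩ ∂U} > 0. Then there exist λ₀ > 0 and x₀ ∈ C ∩ ∂U such that x₀ = λ₀·T(x₀). -/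
open Set

/-- A finite set is dominant when every `z` lies below it for at least one of the orders. -/
def ScarfDom {ι α : Type*} (r : ι → α → ℕ) (σ : Finset α) : Prop :=
  ∀ z, ∃ k, ∀ x ∈ σ, r k z ≤ r k x

open Classical in
lemma scarf_door {ι α : Type*} [Fintype ι] [Fintype α] [DecidableEq α] (r : ι → α → ℕ)
    (hinj : ∀ k, Function.Injective (r k)) (τ : Finset α) (hτ : τ.card + 1 = Fintype.card ι)
    (hne : τ.Nonempty) (hM : ∀ i, ∃ y, ∀ k, k ≠ i → ∃ x ∈ τ, r k x < r k y) :
    Even (Finset.univ.filter (fun y => y ∉ τ ∧ ScarfDom r (insert y τ))).card := by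
  by_cases hD : ScarfDom r τ
  swap
  · rw [Finset.filter_false_of_mem]
    · simp
    · rintro y - ⟨_, h⟩
      apply hD
      intro z
      obtain ⟨k, hk⟩ := h z
      exact ⟨k, fun x hx => hk x (Finset.mem_insert_of_mem hx)⟩
  have hm : ∀ k, ∃ x ∈ τ, ∀ x' ∈ τ, r k x ≤ r k x' := fun k => Finset.exists_min_image τ (r k) hne
  choose m hmτ hmle using hm
  have hsurj : ∀ x ∈ τ, ∃ k, m k = x := by
    intro x hx
    obtain ⟨k, hk⟩ := hD x
    exact ⟨k, hinj k (le_antisymm (hmle k x hx) (hk _ (hmτ k)))⟩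
  have himg : Finset.univ.image m = τ := by
    ext x
    simp only [Finset.mem_image, Finset.mem_univ, true_and]
    exact ⟨by rintro ⟨k, rfl⟩; exact hmτ k, hsurj x⟩
  obtain ⟨i, j, hij, hmij⟩ : ∃ i j, i ≠ j ∧ m i = m j := by
    by_contra! hcon
    have : Function.Injective m := fun a b hab => by
      by_contra hne'
      exact hcon a b hne' hab
    have h2 := Finset.card_image_of_injective Finset.univ this
    rw [himg, Finset.card_univ] at h2
    omega
  have key : ∀ a b, a ≠ b → m a = m b → ∀ k l, k ≠ a → l ≠ a → m k = m l → k = l := by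
    intro a b hab hmab
    have him : (Finset.univ.erase a).image m = τ := by
      ext x
      simp only [Finset.mem_image, Finset.mem_erase, Finset.mem_univ, and_true]
      constructor
      · rintro ⟨k, _, rfl⟩; exact hmτ k
      · intro hx
        obtain ⟨k, rfl⟩ := hsurj x hx
        by_cases hk : k = a
        · exact ⟨b, hab.symm, by rw [hk, hmab]⟩
        · exact ⟨k, hk, rfl⟩
    have hc : ((Finset.univ.erase a).image m).card = (Finset.univ.erase a).card := by
      rw [him, Finset.card_erase_of_mem (Finset.mem_univ _), Finset.card_univ]; omega
    rw [Finset.card_image_iff] at hc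
    intro k l hk hl hkl
    exact hc (by simpa using hk) (by simpa using hl) hkl
  -- the candidates
  have hex : ∀ a, ∃ y, (∀ k, k ≠ a → r k (m k) < r k y) ∧
      ∀ z, (∀ k, k ≠ a → r k (m k) < r k z) → r a z ≤ r a y := by
    intro a
    obtain ⟨y0, hy0⟩ := hM a
    obtain ⟨y, hy, hmax⟩ := Finset.exists_max_image
      (Finset.univ.filter (fun y => ∀ k, k ≠ a → r k (m k) < r k y)) (r a)
      ⟨y0, by
        simp only [Finset.mem_filter, Finset.mem_univ, true_and]
        intro k hk
        obtain ⟨x, hx, hlt⟩ := hy0 k hk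
        exact (hmle k x hx).trans_lt hlt⟩
    simp only [Finset.mem_filter, Finset.mem_univ, true_and] at hy hmax
    exact ⟨y, hy, hmax⟩
  have hgood : ∀ a b y, a ≠ b → m a = m b → (∀ k, k ≠ a → r k (m k) < r k y) →
      (∀ z, (∀ k, k ≠ a → r k (m k) < r k z) → r a z ≤ r a y) →
      y ∉ τ ∧ ScarfDom r (insert y τ) := by
    intro a b y hab hmab hy hmax
    constructor
    · intro hyτ
      obtain ⟨k, rfl⟩ := hsurj y hyτ
      by_cases hk : k = a
      · have := hy b hab.symm
        rw [hk, hmab] at this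
        exact lt_irrefl _ this
      · exact lt_irrefl _ (hy k hk)
    · intro z
      by_cases hz : ∀ k, k ≠ a → r k (m k) < r k z
      · obtain ⟨k, hk⟩ := hD z
        have hka : k = a := by
          by_contra hne'
          exact absurd (hz k hne') (not_lt.2 (hk _ (hmτ k)))
        subst hka
        refine ⟨k, fun x hx => ?_⟩
        rcases Finset.mem_insert.1 hx with rfl | hx
        · exact hmax z hz
        · exact hk x hx
      · push Not at hz
        obtain ⟨k, hka, hk⟩ := hz
        refine ⟨k, fun x hx => ?_⟩
        rcases Finset.mem_insert.1 hx with rfl | hx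
        · exact hk.trans (hy k hka).le
        · exact hk.trans (hmle k x hx)
  have hconv : ∀ a b y, a ≠ b → m a = m b → y ∉ τ → ScarfDom r (insert y τ) →
      r a y < r a (m a) → (∀ k, k ≠ a → r k (m k) < r k y) ∧
      (∀ z, (∀ k, k ≠ a → r k (m k) < r k z) → r a z ≤ r a y) := by
    intro a b y hab hmab hyτ hDy hlt
    have h1 : ∀ k, k ≠ a → r k (m k) < r k y := by
      intro k hka
      obtain ⟨l, hl⟩ := hDy (m k)
      have hl1 := hl y (Finset.mem_insert_self _ _)
      have hl2 : m k = m l :=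
        hinj l (le_antisymm (hl _ (Finset.mem_insert_of_mem (hmτ l))) (hmle l _ (hmτ k)))
      have hla : l ≠ a := by
        rintro rfl
        rw [hl2] at hl1
        omega
      have := key a b hab hmab k l hka hla hl2
      subst this
      refine lt_of_le_of_ne hl1 fun h => hyτ ?_
      rw [← hinj k h]
      exact hmτ k
    refine ⟨h1, fun z hz => ?_⟩
    obtain ⟨k, hk⟩ := hDy z
    have hka : k = a := by
      by_contra hne'
      exact absurd (hz k hne') (not_lt.2 (hk _ (Finset.mem_insert_of_mem (hmτ k))))
    subst hka
    exact hk y (Finset.mem_insert_self _ _)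
  obtain ⟨yi, hyi, hyimax⟩ := hex i
  obtain ⟨yj, hyj, hyjmax⟩ := hex j
  have hne2 : yi ≠ yj := by
    rintro rfl
    obtain ⟨k, hk⟩ := hD yi
    have hk' := hk _ (hmτ k)
    by_cases hki : k = i
    · exact absurd (hyj k (by rw [hki]; exact hij)) (not_lt.2 hk')
    · exact absurd (hyi k hki) (not_lt.2 hk')
  have hset : Finset.univ.filter (fun y => y ∉ τ ∧ ScarfDom r (insert y τ)) = {yi, yj} := by
    ext y
    simp only [Finset.mem_filter, Finset.mem_univ, true_and, Finset.mem_insert,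
      Finset.mem_singleton]
    constructor
    · rintro ⟨hyτ, hDy⟩
      obtain ⟨k, hk⟩ := hDy y
      have hkm : r k y < r k (m k) := by
        refine lt_of_le_of_ne (hk _ (Finset.mem_insert_of_mem (hmτ k))) fun h => hyτ ?_
        rw [hinj k h]; exact hmτ k
      obtain ⟨l, hl⟩ := hDy (m k)
      have hl1 := hl y (Finset.mem_insert_self _ _)
      have hl2 : m k = m l :=
        hinj l (le_antisymm (hl _ (Finset.mem_insert_of_mem (hmτ l))) (hmle l _ (hmτ k)))
      have hlk : l ≠ k := by
        rintro rfl
        omega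
      have hk3 : k = i ∨ k = j := by
        by_contra! hcon
        by_cases hli : l = i
        · have := key i j hij hmij k j hcon.1 hij.symm (by rw [hl2, hli, hmij])
          exact hcon.2 this
        · exact hlk (key i j hij hmij l k hli hcon.1 hl2.symm)
      rcases hk3 with rfl | rfl
      · left
        obtain ⟨h1, h2⟩ := hconv k j y hij hmij hyτ hDy hkm
        exact hinj k (le_antisymm (hyimax y h1) (h2 _ hyi))
      · right
        obtain ⟨h1, h2⟩ := hconv k i y hij.symm hmij.symm hyτ hDy hkm
        exact hinj k (le_antisymm (hyjmax y h1) (h2 _ hyj))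
    · rintro (rfl | rfl)
      · exact hgood i j _ hij hmij hyi hyimax
      · exact hgood j i _ hij.symm hmij.symm hyj hyjmax
  rw [hset, Finset.card_pair hne2]
  exact even_two

open Classical in
lemma scarf_room {ι α : Type*} [Fintype ι] [DecidableEq α] (c : α → ι) (i₀ : ι)
    (σ : Finset α) (hσ : σ.card = Fintype.card ι) (hc : σ.image c ≠ Finset.univ) :
    Even (σ.filter (fun x => (σ.erase x).image c = Finset.univ.erase i₀)).card := by
  rcases (σ.filter (fun x => (σ.erase x).image c = Finset.univ.erase i₀)).eq_empty_or_nonempty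
    with h | ⟨x, hx⟩
  · rw [h]; simp
  obtain ⟨hxσ, hx⟩ := Finset.mem_filter.1 hx
  have hcard : ((σ.erase x).image c).card = (σ.erase x).card := by
    rw [hx, Finset.card_erase_of_mem (Finset.mem_univ _), Finset.card_erase_of_mem hxσ, hσ,
      Finset.card_univ]
  rw [Finset.card_image_iff] at hcard
  have hmem : ∀ w, w ≠ x → w ∈ σ → c w ≠ i₀ := by
    intro w hw hwσ
    have : c w ∈ (σ.erase x).image c := Finset.mem_image_of_mem _ (Finset.mem_erase.2 ⟨hw, hwσ⟩)
    rw [hx] at this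
    exact (Finset.mem_erase.1 this).1
  have hcx : c x ≠ i₀ := by
    intro h
    apply hc
    rw [← Finset.insert_erase hxσ, Finset.image_insert, hx, h]
    exact Finset.insert_erase (Finset.mem_univ _)
  have : c x ∈ (σ.erase x).image c := by
    rw [hx]; exact Finset.mem_erase.2 ⟨hcx, Finset.mem_univ _⟩
  obtain ⟨x', hx', hxx'⟩ := Finset.mem_image.1 this
  obtain ⟨hne, hx'σ⟩ := Finset.mem_erase.1 hx'
  have hall : ∀ w ∈ σ, c w ≠ i₀ := by
    intro w hw
    by_cases h : w = x
    · rw [h]; exact hcx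
    · exact hmem w h hw
  have hset : σ.filter (fun x => (σ.erase x).image c = Finset.univ.erase i₀) = {x, x'} := by
    ext w
    simp only [Finset.mem_filter, Finset.mem_insert, Finset.mem_singleton]
    constructor
    · rintro ⟨hw, hwi⟩
      by_contra! hcon
      have : c w ∈ (σ.erase w).image c := by
        rw [hwi]; exact Finset.mem_erase.2 ⟨hall w hw, Finset.mem_univ _⟩
      obtain ⟨v, hv, hvw⟩ := Finset.mem_image.1 this
      obtain ⟨hvne, hvσ⟩ := Finset.mem_erase.1 hv
      by_cases hvx : v = x
      · exact hcon.2 (hcard (by simp [hcon.1, hw]) (by simp [hne, hx'σ]) (by rw [hxx', ← hvw, hvx]))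
      · exact hvne (hcard (by simp [hvx, hvσ]) (by simp [hcon.1, hw]) hvw)
    · rintro (rfl | rfl)
      · exact ⟨hxσ, hx⟩
      · refine ⟨hx'σ, ?_⟩
        rw [← hx]
        ext k
        simp only [Finset.mem_image, Finset.mem_erase]
        constructor
        · rintro ⟨v, ⟨h1, h2⟩, rfl⟩
          by_cases hvx : v = x
          · exact ⟨w, ⟨hne, hx'σ⟩, by rw [hvx, hxx']⟩
          · exact ⟨v, ⟨hvx, h2⟩, rfl⟩
        · rintro ⟨v, ⟨h1, h2⟩, rfl⟩
          by_cases hvx : v = w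
          · exact ⟨x, ⟨hne.symm, hxσ⟩, by rw [hvx, hxx']⟩
          · exact ⟨v, ⟨hvx, h2⟩, rfl⟩
  rw [hset, Finset.card_pair hne.symm]
  exact even_two

open Classical in
/-- Scarf's lemma: a colourful dominant set exists. -/
theorem scarf_main {ι T : Type*} [Fintype ι] [Nontrivial ι] [Fintype T] [Nonempty T]
    (r : ι → T ⊕ ι → ℕ) (hinj : ∀ k, Function.Injective (r k))
    (h1 : ∀ k t, r k (.inr k) < r k (.inl t)) 
    (h2 : ∀ k j t, j ≠ k → r k (.inl t) < r k (.inr j)) (c : T → ι) :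
    ∃ σ : Finset (T ⊕ ι), ScarfDom r σ ∧ σ.image (Sum.elim c id) = Finset.univ := by
  by_contra! hcon
  obtain ⟨i₀, j₀, hij⟩ := exists_pair_ne ι
  set c' : T ⊕ ι → ι := Sum.elim c id with hc'
  let R : Finset (Finset (T ⊕ ι)) :=
    Finset.univ.filter (fun σ => σ.card = Fintype.card ι ∧ ScarfDom r σ)
  let D : Finset (Finset (T ⊕ ι)) :=
    Finset.univ.filter (fun τ => τ.card + 1 = Fintype.card ι ∧ τ.image c' = Finset.univ.erase i₀)
  have hdc := Finset.sum_card_bipartiteAbove_eq_sum_card_bipartiteBelow (s := D) (t := R)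
    (fun τ σ => τ ⊆ σ)
  have hcpos : 0 < Fintype.card ι := Fintype.card_pos
  have hE : Even (∑ b ∈ R, (Finset.bipartiteBelow (fun τ σ => τ ⊆ σ) D b).card) := by
    apply Finset.even_sum
    intro σ hσ
    simp only [R, Finset.mem_filter, Finset.mem_univ, true_and] at hσ
    have := scarf_room c' i₀ σ hσ.1 (hcon σ hσ.2)
    refine (congrArg Even ?_).mp this
    apply Finset.card_bij (fun x _ => σ.erase x)
    · intro x hx
      obtain ⟨hx, hxi⟩ := Finset.mem_filter.1 hx
      simp only [Finset.bipartiteBelow, D, Finset.mem_filter, Finset.mem_univ, true_and]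
      refine ⟨⟨?_, hxi⟩, Finset.erase_subset _ _⟩
      rw [Finset.card_erase_of_mem hx]; omega
    · intro x hx y hy hxy
      exact Finset.erase_injOn σ (Finset.mem_filter.1 hx).1 (Finset.mem_filter.1 hy).1 hxy
    · intro τ hτ
      simp only [Finset.bipartiteBelow, D, Finset.mem_filter, Finset.mem_univ, true_and] at hτ
      obtain ⟨⟨h3, h4⟩, h5⟩ := hτ
      obtain ⟨x, hx⟩ : ∃ x, σ \ τ = {x} := by
        rw [← Finset.card_eq_one, Finset.card_sdiff_of_subset h5]; omega
      have hxσ : x ∈ σ \ τ := by rw [hx]; simp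
      have heq : σ.erase x = τ := by
        rw [Finset.erase_eq, ← hx]
        exact Finset.sdiff_sdiff_eq_self h5
      refine ⟨x, ?_, heq⟩
      rw [Finset.mem_filter, heq]
      exact ⟨(Finset.mem_sdiff.1 hxσ).1, h4⟩
  have hAb : ∀ τ ∈ D, (Finset.bipartiteAbove (fun τ σ => τ ⊆ σ) R τ).card =
      (Finset.univ.filter (fun y => y ∉ τ ∧ ScarfDom r (insert y τ))).card := by
    intro τ hτ
    simp only [D, Finset.mem_filter, Finset.mem_univ, true_and] at hτ
    symm
    apply Finset.card_bij (fun y _ => insert y τ)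
    · intro y hy
      simp only [Finset.mem_filter, Finset.mem_univ, true_and] at hy
      simp only [Finset.bipartiteAbove, R, Finset.mem_filter, Finset.mem_univ, true_and]
      refine ⟨⟨?_, hy.2⟩, Finset.subset_insert _ _⟩
      rw [Finset.card_insert_of_notMem hy.1]; exact hτ.1
    · intro x hx y hy hxy
      simp only [Finset.mem_filter, Finset.mem_univ, true_and] at hx hy
      exact (Finset.insert_inj hx.1).1 hxy
    · intro σ hσ
      simp only [Finset.bipartiteAbove, R, Finset.mem_filter, Finset.mem_univ, true_and] at hσ
      obtain ⟨⟨h3, h4⟩, h5⟩ := hσ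
      obtain ⟨x, hx⟩ : ∃ x, σ \ τ = {x} := by
        rw [← Finset.card_eq_one, Finset.card_sdiff_of_subset h5]; omega
      have hxσ : x ∈ σ \ τ := by rw [hx]; simp
      have heq : insert x τ = σ := by
        rw [Finset.insert_eq, ← hx]
        exact Finset.sdiff_union_of_subset h5
      refine ⟨x, ?_, heq⟩
      rw [Finset.mem_filter, heq]
      exact ⟨Finset.mem_univ _, (Finset.mem_sdiff.1 hxσ).2, h4⟩
  let τ₀ : Finset (T ⊕ ι) := (Finset.univ.erase i₀).image Sum.inr
  have hτ₀ : τ₀ ∈ D := by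
    simp only [D, Finset.mem_filter, Finset.mem_univ, true_and, τ₀]
    constructor
    · rw [Finset.card_image_of_injective _ Sum.inr_injective,
        Finset.card_erase_of_mem (Finset.mem_univ _), Finset.card_univ]
      omega
    · rw [Finset.image_image]
      have : c' ∘ Sum.inr = id := by ext; simp [hc']
      rw [this, Finset.image_id]
  have hmem₀ : ∀ x, x ∈ τ₀ ↔ ∃ k, k ≠ i₀ ∧ x = .inr k := by
    intro x
    simp only [τ₀, Finset.mem_image, Finset.mem_erase, Finset.mem_univ, and_true]
    exact ⟨fun ⟨k, h, e⟩ => ⟨k, h, e.symm⟩, fun ⟨k, h, e⟩ => ⟨k, h, e.symm⟩⟩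
  have hO : (Finset.univ.filter (fun y => y ∉ τ₀ ∧ ScarfDom r (insert y τ₀))).card = 1 := by
    rw [Finset.card_eq_one]
    obtain ⟨t, -, ht⟩ := Finset.exists_max_image Finset.univ (fun t : T => r i₀ (.inl t))
      Finset.univ_nonempty
    refine ⟨.inl t, ?_⟩
    ext y
    simp only [Finset.mem_filter, Finset.mem_univ, true_and, Finset.mem_singleton]
    constructor
    · rintro ⟨hy, hd⟩
      obtain ⟨k, hk⟩ := hd (.inl t)
      have hki : k = i₀ := by
        by_contra hne
        have := hk (.inr k) (Finset.mem_insert_of_mem ((hmem₀ _).2 ⟨k, hne, rfl⟩))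
        exact absurd (h1 k t) (not_lt.2 this)
      subst hki
      have h3 := hk y (Finset.mem_insert_self _ _)
      rcases y with s | j
      · exact hinj k (le_antisymm (ht s (Finset.mem_univ _)) h3)
      · by_cases hj : j = k
        · subst hj
          exact absurd (h1 j t) (not_lt.2 h3)
        · exact absurd ((hmem₀ _).2 ⟨j, hj, rfl⟩) hy
    · rintro rfl
      refine ⟨fun h => ?_, fun z => ?_⟩
      · obtain ⟨k, _, h⟩ := (hmem₀ _).1 h
        cases h
      · rcases z with s | j
        · refine ⟨i₀, fun x hx => ?_⟩
          rcases Finset.mem_insert.1 hx with rfl | hx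
          · exact ht s (Finset.mem_univ _)
          · obtain ⟨k, hk, rfl⟩ := (hmem₀ _).1 hx
            exact (h2 _ _ _ hk).le
        · refine ⟨j, fun x hx => ?_⟩
          rcases x with s | k
          · exact (h1 _ _).le
          · by_cases hk : k = j
            · rw [hk]
            · exact ((h1 j t).trans (h2 j k t hk)).le
  have hO' : Odd (∑ a ∈ D, (Finset.bipartiteAbove (fun τ σ => τ ⊆ σ) R a).card) := by
    rw [← Finset.add_sum_erase D _ hτ₀, hAb _ hτ₀, hO]
    rw [Nat.odd_add]
    refine iff_of_true odd_one ?_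
    apply Finset.even_sum
    intro τ hτ
    obtain ⟨hne, hτ⟩ := Finset.mem_erase.1 hτ
    rw [hAb τ hτ]
    simp only [D, Finset.mem_filter, Finset.mem_univ, true_and] at hτ
    have hc2 : 1 < Fintype.card ι := Fintype.one_lt_card
    obtain ⟨t, ht⟩ : ∃ t : T, Sum.inl t ∈ τ := by
      by_contra! hno
      apply hne
      apply Finset.eq_of_subset_of_card_le
      · intro x hx
        rcases x with t | k
        · exact absurd hx (hno t)
        · rw [hmem₀]
          refine ⟨k, ?_, rfl⟩
          have : c' (.inr k) ∈ τ.image c' := Finset.mem_image_of_mem _ hx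
          rw [hτ.2] at this
          exact (Finset.mem_erase.1 this).1
      · simp only [D, Finset.mem_filter, Finset.mem_univ, true_and] at hτ₀
        omega
    refine scarf_door r hinj τ hτ.1 ⟨_, ht⟩ fun i => ⟨.inr i, fun k hk => ⟨_, ht, h2 _ _ _ hk.symm⟩⟩
  rw [hdc] at hO'
  exact (Nat.not_even_iff_odd.2 hO') hE

open Classical in
lemma grid_approx {ι : Type*} [Fintype ι] [Nontrivial ι] (f : (ι → ℝ) → (ι → ℝ))
    (hf : ∀ x ∈ stdSimplex ℝ ι, f x ∈ stdSimplex ℝ ι) (N : ℕ) (hN : 0 < N) :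
    ∃ x ∈ stdSimplex ℝ ι, ∀ i, ∃ x' ∈ stdSimplex ℝ ι,
      dist x' x ≤ (Fintype.card ι : ℝ) / N ∧ x' i ≤ f x' i + (Fintype.card ι : ℝ) / N := by
  have hNR : (0:ℝ) < N := by exact_mod_cast hN
  let T := {v : ι → Fin (N + 1) // ∑ i, (v i : ℕ) = N}
  have mkT : ∀ y : ι → ℕ, ∑ i, y i = N → ∃ t : T, ∀ i, ((t.1 i : ℕ)) = y i := by
    intro y hy
    have hle : ∀ i, y i < N + 1 := by
      intro i
      have := Finset.single_le_sum (f := y) (fun _ _ => Nat.zero_le _) (Finset.mem_univ i)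
      omega
    exact ⟨⟨fun i => ⟨y i, hle i⟩, hy⟩, fun i => rfl⟩
  obtain ⟨k00⟩ : Nonempty ι := inferInstance
  obtain ⟨t0, -⟩ := mkT (fun i => if i = k00 then N else 0) (by simp)
  have : Nonempty T := ⟨t0⟩
  set M := Fintype.card T with hM
  let e : T ≃ Fin M := Fintype.equivFin T
  let g : ι ≃ Fin (Fintype.card ι) := Fintype.equivFin ι
  let r : ι → T ⊕ ι → ℕ := fun k => Sum.elim (fun t => (t.1 k : ℕ) * M + (e t : ℕ) + 1)
    (fun j => if j = k then 0 else (N + 1) * M + 1 + (g j : ℕ))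
  have hrl : ∀ k t, r k (.inl t) = (t.1 k : ℕ) * M + (e t : ℕ) + 1 := fun _ _ => rfl
  have hrr : ∀ k j, r k (.inr j) = if j = k then 0 else (N + 1) * M + 1 + (g j : ℕ) :=
    fun _ _ => rfl
  have hbig : ∀ k t, r k (.inl t) < (N + 1) * M + 1 := by
    intro k t
    rw [hrl]
    have h3 : (t.1 k : ℕ) ≤ N := Nat.lt_succ_iff.1 (t.1 k).2
    have h4 := (e t).2
    have := Nat.mul_le_mul_right M h3
    rw [Nat.add_mul]
    omega
  have h1 : ∀ k t, r k (.inr k) < r k (.inl t) := by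
    intro k t
    rw [hrr, hrl, if_pos rfl]; omega
  have h2 : ∀ k j t, j ≠ k → r k (.inl t) < r k (.inr j) := by
    intro k j t hj
    have := hbig k t
    rw [hrr, if_neg hj]; omega
  have hinj : ∀ k, Function.Injective (r k) := by
    intro k a b hab
    rcases a with s | i <;> rcases b with t | j
    · rw [hrl, hrl] at hab
      have hs := (e s).2
      have ht := (e t).2
      have h3 : ((s.1 k : ℕ) * M + (e s : ℕ)) % M = ((t.1 k : ℕ) * M + (e t : ℕ)) % M := by
        congr 1; omega
      rw [Nat.mul_add_mod_of_lt hs, Nat.mul_add_mod_of_lt ht] at h3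
      exact congrArg _ (e.injective (Fin.ext h3))
    · exfalso
      by_cases hj : j = k
      · have := h1 k s; rw [hj] at hab; omega
      · have := h2 k j s hj; omega
    · exfalso
      by_cases hj : i = k
      · have := h1 k t; rw [hj] at hab; omega
      · have := h2 k i t hj; omega
    · rw [hrr, hrr] at hab
      by_cases hi : i = k <;> by_cases hj : j = k
      · rw [hi, hj]
      · rw [if_pos hi, if_neg hj] at hab; omega
      · rw [if_neg hi, if_pos hj] at hab; omega
      · rw [if_neg hi, if_neg hj] at hab
        exact congrArg _ (g.injective (Fin.ext (by omega)))
  let p : T → ι → ℝ := fun t i => ((t.1 i : ℕ) : ℝ) / N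
  have hp : ∀ t, p t ∈ stdSimplex ℝ ι := by
    intro t
    refine ⟨fun i => by positivity, ?_⟩
    simp only [p]
    rw [← Finset.sum_div, ← Nat.cast_sum, t.2]
    exact div_self hNR.ne'
  have hcol : ∀ t, ∃ i, p t i ≤ f (p t) i := by
    intro t
    by_contra! hcon
    have := Finset.sum_lt_sum_of_nonempty (s := Finset.univ) Finset.univ_nonempty
      (fun i _ => hcon i)
    rw [(hp t).2, (hf _ (hp t)).2] at this
    exact lt_irrefl _ this
  choose c hc using hcol
  obtain ⟨σ, hσ, hσc⟩ := scarf_main r hinj h1 h2 c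
  have hcol2 : ∀ k, Sum.inr k ∉ σ → ∃ t, Sum.inl t ∈ σ ∧ c t = k := by
    intro k hk
    have : k ∈ σ.image (Sum.elim c id) := by rw [hσc]; exact Finset.mem_univ _
    obtain ⟨x, hx, hxk⟩ := Finset.mem_image.1 this
    rcases x with t | j
    · exact ⟨t, hx, hxk⟩
    · simp only [Sum.elim_inr, id] at hxk
      rw [hxk] at hx
      exact absurd hx hk
  have hdom : ∀ t : T, ∃ k, Sum.inr k ∉ σ ∧ ∀ x ∈ σ, r k (.inl t) ≤ r k x := by
    intro t
    obtain ⟨k, hk⟩ := hσ (.inl t)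
    exact ⟨k, fun h => absurd (h1 k t) (not_lt.2 (hk _ h)), hk⟩
  obtain ⟨k0, hk0, -⟩ := hdom t0
  obtain ⟨s, hs, -⟩ := hcol2 k0 hk0
  have hmin : ∀ k, ∃ t : T, Sum.inl t ∈ σ ∧ ∀ t' : T, Sum.inl t' ∈ σ → (t.1 k : ℕ) ≤ t'.1 k := by
    intro k
    obtain ⟨t, ht, h⟩ := Finset.exists_min_image
      (Finset.univ.filter (fun t : T => Sum.inl t ∈ σ)) (fun t => (t.1 k : ℕ)) ⟨s, by simp [hs]⟩
    simp only [Finset.mem_filter, Finset.mem_univ, true_and] at ht h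
    exact ⟨t, ht, h⟩
  choose q hqσ hq using hmin
  let m : ι → ℕ := fun k => if Sum.inr k ∈ σ then 0 else (q k).1 k
  have hmle : ∀ t : T, Sum.inl t ∈ σ → ∀ k, m k ≤ t.1 k := by
    intro t ht k
    simp only [m]
    split_ifs
    · exact Nat.zero_le _
    · exact hq k t ht
  have hsum : N < ∑ k, (m k + 1) := by
    by_contra! hcon
    obtain ⟨y, hy⟩ := mkT (fun k => (m k + 1) + if k = k0 then N - ∑ k, (m k + 1) else 0) (by
      rw [Finset.sum_add_distrib, Finset.sum_ite_eq' Finset.univ k0]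
      simp only [Finset.mem_univ, if_true]
      omega)
    obtain ⟨k, hk, hky⟩ := hdom y
    have h3 := hky _ (hqσ k)
    rw [hrl, hrl] at h3
    have h4 : m k = (q k).1 k := if_neg hk
    have h5 : ((q k).1 k : ℕ) + 1 ≤ y.1 k := by
      rw [hy, ← h4]; omega
    have h6 := Nat.mul_le_mul_right M h5
    have h7 := (e (q k)).2
    rw [Nat.add_mul] at h6
    omega
  have hub : ∀ t : T, Sum.inl t ∈ σ → ∀ k, (t.1 k : ℕ) ≤ m k + Fintype.card ι := by
    intro t ht k
    have h3 : ∑ k, (t.1 k : ℕ) = N := t.2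
    rw [Finset.sum_add_distrib] at hsum
    simp only [Finset.sum_const, Finset.card_univ, smul_eq_mul, mul_one] at hsum
    rw [← Finset.add_sum_erase _ _ (Finset.mem_univ k)] at h3
    rw [← Finset.add_sum_erase _ m (Finset.mem_univ k)] at hsum
    have h4 : ∑ k ∈ Finset.univ.erase k, m k ≤ ∑ k ∈ Finset.univ.erase k, (t.1 k : ℕ) :=
      Finset.sum_le_sum fun k _ => hmle t ht k
    omega
  refine ⟨p s, hp s, fun i => ?_⟩
  by_cases hi : Sum.inr i ∈ σ
  · refine ⟨p s, hp s, by rw [dist_self]; positivity, ?_⟩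
    have h3 := hub s hs i
    have h4 : m i = 0 := if_pos hi
    have h5 := (hf _ (hp s)).1 i
    have h6 : p s i ≤ (Fintype.card ι : ℝ) / N := by
      simp only [p]
      gcongr
      rw [h4] at h3; simpa using h3
    linarith
  · obtain ⟨t, ht, rfl⟩ := hcol2 i hi
    refine ⟨p t, hp t, ?_, ?_⟩
    · rw [dist_pi_le_iff (by positivity)]
      intro k
      have a1 := hub t ht k
      have a2 := hub s hs k
      have a3 := hmle t ht k
      have a4 := hmle s hs k
      rw [Real.dist_eq]
      simp only [p]
      rw [← sub_div, abs_div, abs_of_pos hNR]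
      gcongr
      rw [abs_le]
      have b1 : ((t.1 k : ℕ) : ℝ) ≤ (s.1 k : ℕ) + Fintype.card ι := by
        exact_mod_cast (by omega : (t.1 k : ℕ) ≤ (s.1 k : ℕ) + Fintype.card ι)
      have b2 : ((s.1 k : ℕ) : ℝ) ≤ (t.1 k : ℕ) + Fintype.card ι := by
        exact_mod_cast (by omega : (s.1 k : ℕ) ≤ (t.1 k : ℕ) + Fintype.card ι)
      constructor <;> linarith
    · have : (0:ℝ) ≤ (Fintype.card ι : ℝ) / N := by positivity
      linarith [hc t]

open Filter Topology in
/-- Brouwer's fixed point theorem on the standard simplex. -/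
theorem brouwer_simplex {ι : Type*} [Fintype ι] [Nontrivial ι] (f : (ι → ℝ) → (ι → ℝ))
    (hf : ∀ x ∈ stdSimplex ℝ ι, f x ∈ stdSimplex ℝ ι) (hfc : ContinuousOn f (stdSimplex ℝ ι)) :
    ∃ x ∈ stdSimplex ℝ ι, f x = x := by
  have h := fun N : ℕ => grid_approx f hf (N + 1) N.succ_pos
  choose x hx x' hx' hd hle using h
  obtain ⟨z, hz, φ, hφ, hlim⟩ := (isCompact_stdSimplex ℝ ι).tendsto_subseq hx
  have h0 : Tendsto (fun N : ℕ => (Fintype.card ι : ℝ) / ((φ N + 1 : ℕ) : ℝ)) atTop (𝓝 0) :=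
    ((tendsto_const_div_atTop_nhds_zero_nat (Fintype.card ι : ℝ)).comp
      (tendsto_add_atTop_nat 1)).comp hφ.tendsto_atTop
  have hzle : ∀ i, z i ≤ f z i := by
    intro i
    have h1 : Tendsto (fun N => x' (φ N) i) atTop (𝓝 z) := by
      refine (tendsto_iff_of_dist ?_).1 hlim
      refine squeeze_zero (fun _ => dist_nonneg) (fun N => ?_) h0
      rw [dist_comm]
      exact hd (φ N) i
    have h2 : Tendsto (fun N => f (x' (φ N) i)) atTop (𝓝 (f z)) :=
      (hfc z hz).tendsto.comp (tendsto_nhdsWithin_iff.2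
        ⟨h1, Eventually.of_forall fun N => hx' (φ N) i⟩)
    have h3 := ((tendsto_pi_nhds.1 h2 i).add h0)
    rw [add_zero] at h3
    exact le_of_tendsto_of_tendsto' (tendsto_pi_nhds.1 h1 i) h3 fun N => hle (φ N) i
  refine ⟨z, hz, ?_⟩
  have hs : ∑ i, z i = ∑ i, f z i := by rw [hz.2, (hf z hz).2]
  have := (Finset.sum_eq_sum_iff_of_le (fun i _ => hzle i)).1 hs
  ext i
  exact (this i (Finset.mem_univ i)).symm

lemma cone_sum_mem {X ι : Type*} [NormedAddCommGroup X] [NormedSpace ℝ X]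
    {C : Set X} (h0 : (0:X) ∈ C) (hadd : ∀ x ∈ C, ∀ y ∈ C, x + y ∈ C)
    (s : Finset ι) (v : ι → X) (hv : ∀ i ∈ s, v i ∈ C) : ∑ i ∈ s, v i ∈ C :=
  Finset.sum_induction v (· ∈ C) (fun a b ha hb => hadd a ha b hb) h0 hv

open Filter Topology in
lemma approx_eigen {X : Type*} [NormedAddCommGroup X] [NormedSpace ℝ X]
    (C : Set X) (hCcl : IsClosed C) (h0C : (0:X) ∈ C) (hadd : ∀ x ∈ C, ∀ y ∈ C, x + y ∈ C)
    (hCsm : ∀ μ : ℝ, 0 ≤ μ → ∀ x ∈ C, μ • x ∈ C)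
    (hCpt : C ∩ (-C) = {0})
    (U : Set X) (hUo : IsOpen U) (hUb : Bornology.IsBounded U) (hU0 : (0:X) ∈ U)
    (T : X → X) (hBne : (C ∩ frontier U).Nonempty)
    (hTc : ContinuousOn T (C ∩ frontier U))
    (A : Set X) (hA : IsCompact A) (hTA : ∀ x ∈ C ∩ frontier U, T x ∈ A)
    (hAC : A ⊆ C) (hA0 : (0:X) ∉ A) (ε : ℝ) (hε : 0 < ε) :
    ∃ x ∈ C ∩ frontier U, ∃ lam : ℝ, 0 ≤ lam ∧ ∃ y, ‖y - T x‖ ≤ ε ∧ x = lam • y := by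
  set B := C ∩ frontier U with hB
  have hBcl : IsClosed B := hCcl.inter isClosed_frontier
  obtain ⟨t, htA, htf, htc⟩ := hA.finite_cover_balls hε
  have : Fintype t := htf.fintype
  let a : t → X := Subtype.val
  have haC : ∀ i, a i ∈ C := fun i => hAC (htA i.2)
  have ha0 : ∀ i, a i ≠ 0 := fun i h => hA0 (h ▸ htA i.2)
  have hnear : ∀ x ∈ B, ∃ i : t, ‖T x - a i‖ < ε := by
    intro x hx
    have := htc (hTA x hx)
    simp only [mem_iUnion, Metric.mem_ball, dist_eq_norm] at this
    obtain ⟨i, hi, h⟩ := this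
    exact ⟨⟨i, hi⟩, h⟩
  obtain ⟨b0, hb0⟩ := hBne
  obtain ⟨i0, -⟩ := hnear b0 hb0
  have : Nonempty t := ⟨i0⟩
  -- Tietze extension of the weights
  have hW : ∀ i : t, ∃ W : C(X, ℝ), ∀ x ∈ B, W x = ε - ‖T x - a i‖ := by
    intro i
    let w : C(B, ℝ) := ⟨fun x => ε - ‖T x - a i‖, by
      have := continuousOn_iff_continuous_domRestrict.1 hTc
      have h2 : Continuous (fun x : B => T x) := this
      exact continuous_const.sub (h2.sub continuous_const).norm⟩
    obtain ⟨W, hW⟩ := ContinuousMap.exists_restrict_eq hBcl w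
    refine ⟨W, fun x hx => ?_⟩
    have := congrArg (fun g : C(B, ℝ) => g ⟨x, hx⟩) hW
    simpa [w] using this
  choose W hW using hW
  let v : t → X → ℝ := fun i x => max 0 (W i x) + Metric.infDist x B
  have hvc : ∀ i, Continuous (v i) := fun i =>
    (continuous_const.max (W i).continuous).add (Metric.continuous_infDist_pt B)
  have hv0 : ∀ i x, 0 ≤ v i x := fun i x => add_nonneg (le_max_left _ _) Metric.infDist_nonneg
  let V : X → ℝ := fun x => ∑ i, v i x
  have hVc : Continuous V := continuous_finsetSum _ fun i _ => hvc i
  have hVpos : ∀ x, 0 < V x := by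
    intro x
    by_cases hx : x ∈ B
    · obtain ⟨i, hi⟩ := hnear x hx
      refine Finset.sum_pos' (fun i _ => hv0 i x) ⟨i, Finset.mem_univ _, ?_⟩
      have h1 : 0 < W i x := by rw [hW i x hx]; linarith
      have h2 := le_max_right 0 (W i x)
      have h3 : 0 ≤ Metric.infDist x B := Metric.infDist_nonneg
      simp only [v]; linarith
    · have h3 : 0 < Metric.infDist x B := (hBcl.notMem_iff_infDist_pos ⟨b0, hb0⟩).1 hx
      refine Finset.sum_pos (fun i _ => ?_) Finset.univ_nonempty
      have := le_max_left 0 (W i x)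
      simp only [v]; linarith
  let g : X → t → ℝ := fun x i => v i x / V x
  have hgc : ∀ i, Continuous (fun x => g x i) := fun i =>
    (hvc i).div hVc fun x => (hVpos x).ne'
  have hgs : ∀ x, g x ∈ stdSimplex ℝ t := by
    intro x
    refine ⟨fun i => div_nonneg (hv0 i x) (hVpos x).le, ?_⟩
    simp only [g]
    rw [← Finset.sum_div]
    exact div_self (hVpos x).ne'
  let G : X → X := fun x => ∑ i, g x i • a i
  have hGc : Continuous G := continuous_finsetSum _ fun i _ => (hgc i).smul continuous_const
  have hGT : ∀ x ∈ B, ‖G x - T x‖ ≤ ε := by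
    intro x hx
    have h1 : G x - T x = ∑ i, g x i • (a i - T x) := by
      simp only [smul_sub, Finset.sum_sub_distrib, ← Finset.sum_smul]
      rw [(hgs x).2, one_smul]
    rw [h1]
    calc ‖∑ i, g x i • (a i - T x)‖ ≤ ∑ i, g x i * ε := by
          refine norm_sum_le_of_le _ fun i _ => ?_
          rw [norm_smul, Real.norm_of_nonneg ((hgs x).1 i)]
          by_cases hi : ‖T x - a i‖ < ε
          · rw [norm_sub_rev]
            exact mul_le_mul_of_nonneg_left hi.le ((hgs x).1 i)
          · have : g x i = 0 := by
              simp only [g, v]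
              rw [hW i x hx, max_eq_left (by linarith), Metric.infDist_zero_of_mem hx]
              simp
            rw [this]; simp
      _ = ε := by rw [← Finset.sum_mul, (hgs x).2, one_mul]
  -- lower bound on convex combinations
  obtain ⟨δ, hδ, hδle⟩ : ∃ δ > 0, ∀ s ∈ stdSimplex ℝ t, δ ≤ ‖∑ i, s i • a i‖ := by
    have hne : (stdSimplex ℝ t).Nonempty := ⟨_, hgs 0⟩
    have hcont : Continuous (fun s : t → ℝ => ‖∑ i, s i • a i‖) := by fun_prop
    obtain ⟨s, hs, hmin⟩ := (isCompact_stdSimplex ℝ t).exists_isMinOn hne hcont.continuousOn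
    refine ⟨_, ?_, fun s' hs' => hmin hs'⟩
    refine norm_pos_iff.2 ?_
    intro hzero
    obtain ⟨i, hi⟩ : ∃ i, 0 < s i := by
      by_contra! hcon
      have h1 : ∑ i, s i ≤ 0 := Finset.sum_nonpos fun i _ => hcon i
      rw [hs.2] at h1
      linarith
    classical
    rw [← Finset.add_sum_erase _ _ (Finset.mem_univ i)] at hzero
    have h1 : s i • a i ∈ C := hCsm _ hi.le _ (haC i)
    have h2 : ∑ j ∈ Finset.univ.erase i, s j • a j ∈ C :=
      cone_sum_mem h0C hadd _ _ fun j _ => hCsm _ (hs.1 j) _ (haC j)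
    have h3 : s i • a i ∈ C ∩ (-C) := ⟨h1, by
      rw [Set.mem_neg, neg_eq_of_add_eq_zero_right hzero]; exact h2⟩
    rw [hCpt, mem_singleton_iff, smul_eq_zero] at h3
    rcases h3 with h3 | h3
    · exact hi.ne' h3
    · exact ha0 i h3
  obtain ⟨R, hR⟩ := hUb.exists_norm_le
  have hR0 : 0 ≤ R := by simpa using hR 0 hU0
  let L : ℝ := (R + 1) / δ
  have hL : 0 ≤ L := by positivity
  have hLδ : L * δ = R + 1 := div_mul_cancel₀ _ hδ.ne'
  by_contra! hcon
  let S : Set X := {x | x ∈ C ∩ closure U ∧ ∃ l ∈ Icc 0 L, x = l • G x}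
  have hScl : IsClosed S := by
    have h1 : IsClosed {q : X × Icc (0:ℝ) L | q.1 = (q.2 : ℝ) • G q.1} := by
      apply isClosed_eq <;> fun_prop
    have h2 := isClosedMap_fst_of_compactSpace _ h1
    have h3 : S = (C ∩ closure U) ∩ Prod.fst '' {q : X × Icc (0:ℝ) L | q.1 = (q.2 : ℝ) • G q.1} := by
      ext x
      simp only [S, mem_ofPred_eq, mem_inter_iff, mem_image, Prod.exists, exists_and_right,
        exists_eq_right, Subtype.exists, exists_prop]
    rw [h3]
    exact (hCcl.inter isClosed_closure).inter h2
  have hdisj : Disjoint (C ∩ Uᶜ) S := by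
    rw [Set.disjoint_left]
    rintro x ⟨hxC, hxU⟩ ⟨⟨-, hxcl⟩, l, hl, hxl⟩
    have hxB : x ∈ B := ⟨hxC, by rw [hUo.frontier_eq]; exact ⟨hxcl, hxU⟩⟩
    exact hcon x hxB l hl.1 (G x) (hGT x hxB) hxl
  obtain ⟨φ, hφ0, hφ1, hφ⟩ := exists_continuous_zero_one_of_isClosed
    (hCcl.inter hUo.isClosed_compl) hScl hdisj
  let P : (Option t → ℝ) → X := fun s => L • ∑ i, s (some i) • a i
  have hPc : Continuous P := by fun_prop
  let F : (Option t → ℝ) → Option t → ℝ := fun s o =>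
    o.elim (1 - φ (P s)) (fun i => φ (P s) * g (P s) i)
  have hF : ∀ s ∈ stdSimplex ℝ (Option t), F s ∈ stdSimplex ℝ (Option t) := by
    intro s _
    have h1 := hφ (P s)
    refine ⟨fun o => ?_, ?_⟩
    · rcases o with _ | i
      · simp only [F, Option.elim]; linarith [h1.2]
      · exact mul_nonneg h1.1 ((hgs _).1 i)
    · rw [Fintype.sum_option]
      simp only [F, Option.elim]
      rw [← Finset.mul_sum, (hgs _).2]
      ring
  have hFc : Continuous F := by
    refine continuous_pi fun o => ?_
    rcases o with _ | i
    · exact continuous_const.sub (φ.continuous.comp hPc)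
    · exact (φ.continuous.comp hPc).mul ((hgc i).comp hPc)
  obtain ⟨s, hs, hsF⟩ := brouwer_simplex F hF hFc.continuousOn
  have hPC : P s ∈ C := hCsm _ hL _
    (cone_sum_mem h0C hadd _ _ fun j _ => hCsm _ (hs.1 _) _ (haC j))
  have hfix : P s = (L * φ (P s)) • G (P s) := by
    have h1 : ∀ i, s (some i) = φ (P s) * g (P s) i := fun i => (congrFun hsF (some i)).symm
    calc P s = L • ∑ i, s (some i) • a i := rfl
      _ = L • ∑ i, (φ (P s) * g (P s) i) • a i := by
          congr 1
          exact Finset.sum_congr rfl fun i _ => by rw [← h1 i]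
      _ = _ := by
          simp only [G, mul_smul, Finset.smul_sum]
  have h0S : (0:X) ∈ S := ⟨⟨h0C, subset_closure hU0⟩, 0, ⟨le_rfl, hL⟩, by simp⟩
  by_cases hz : φ (P s) = 0
  · rw [hz, mul_zero, zero_smul] at hfix
    rw [hfix] at hz
    have := hφ1 h0S
    simp [hz] at this
  · have hPU : P s ∈ U := by
      by_contra hnot
      exact hz (hφ0 ⟨hPC, hnot⟩)
    have hPS : P s ∈ S := by
      refine ⟨⟨hPC, subset_closure hPU⟩, L * φ (P s), ⟨mul_nonneg hL (hφ _).1, ?_⟩, hfix⟩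
      exact mul_le_of_le_one_right hL (hφ _).2
    have h1 : φ (P s) = 1 := hφ1 hPS
    rw [h1, mul_one] at hfix
    have h2 := hR _ hPU
    have h3 : δ ≤ ‖G (P s)‖ := hδle _ (hgs _)
    have h4 : ‖P s‖ = L * ‖G (P s)‖ := by
      conv_lhs => rw [hfix]
      rw [norm_smul, Real.norm_of_nonneg hL]
    have h5 := mul_le_mul_of_nonneg_left h3 hL
    linarith

/-- Birkhoff–Kellogg type theorem in cones, Krasnosel'skii–Ladyzhenskii:
if `C` is a cone in a real Banach space `X`, `U` a bounded open neighbourhood of `0`,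
and `T : C ∩ closure U → C` is a compact operator with
`inf{‖Tx‖ : x ∈ C ∩ ∂U} > 0`, then there exist `λ₀ > 0` and `x₀ ∈ C ∩ ∂U` with
`x₀ = λ₀ • T x₀`. -/
theorem stmt_12 {X : Type*} [NormedAddCommGroup X] [NormedSpace ℝ X] [CompleteSpace X]
    (C : Set X) (hCne : C.Nonempty) (hCcl : IsClosed C) (hCcv : Convex ℝ C)
    (hCsm : ∀ μ : ℝ, 0 ≤ μ → ∀ x ∈ C, μ • x ∈ C)
    (hCpt : C ∩ (-C) = {0})
    (U : Set X) (hUo : IsOpen U) (hUb : Bornology.IsBounded U) (hU0 : (0:X) ∈ U)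
    (T : X → X)
    (hTmap : ∀ x ∈ C ∩ closure U, T x ∈ C)
    (hTc : ContinuousOn T (C ∩ closure U))
    (hTcpt : IsCompact (closure (T '' (C ∩ closure U))))
    (hinf : 0 < sInf ((fun x => ‖T x‖) '' (C ∩ frontier U))) :
    ∃ lam : ℝ, 0 < lam ∧ ∃ x ∈ C ∩ frontier U, x = lam • T x := by
  set B := C ∩ frontier U with hB
  have hBcl : IsClosed B := hCcl.inter isClosed_frontier
  have hBsub : B ⊆ C ∩ closure U := inter_subset_inter_right _ frontier_subset_closure
  obtain ⟨c0, hc0⟩ := hCne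
  have h0C : (0:X) ∈ C := by simpa using hCsm 0 le_rfl c0 hc0
  have hadd : ∀ x ∈ C, ∀ y ∈ C, x + y ∈ C := by
    intro x hx y hy
    have h1 := hCcv hx hy (a := 1/2) (b := 1/2) (by norm_num) (by norm_num) (by norm_num)
    have h2 := hCsm 2 (by norm_num) _ h1
    rw [smul_add, smul_smul, smul_smul] at h2
    norm_num at h2
    exact h2
  have hBne : B.Nonempty := by
    by_contra hne
    rw [not_nonempty_iff_eq_empty] at hne
    rw [hne] at hinf
    simp at hinf
  set m := sInf ((fun x => ‖T x‖) '' B) with hm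
  have hmle : ∀ x ∈ B, m ≤ ‖T x‖ := fun x hx =>
    csInf_le ⟨0, by rintro _ ⟨y, _, rfl⟩; exact norm_nonneg _⟩ ⟨x, hx, rfl⟩
  let A := closure (T '' B)
  have hA : IsCompact A := hTcpt.of_isClosed_subset isClosed_closure
    (closure_mono (image_mono hBsub))
  have hTA : ∀ x ∈ B, T x ∈ A := fun x hx => subset_closure ⟨x, hx, rfl⟩
  have hAC : A ⊆ C := closure_minimal
    (by rintro _ ⟨x, hx, rfl⟩; exact hTmap x (hBsub hx)) hCcl
  have hA0 : (0:X) ∉ A := by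
    intro h
    have h1 : A ⊆ {y | m ≤ ‖y‖} := closure_minimal
      (by rintro _ ⟨x, hx, rfl⟩; exact hmle x hx) (isClosed_le continuous_const continuous_norm)
    have h2 : m ≤ ‖(0:X)‖ := h1 h
    rw [norm_zero] at h2
    linarith
  have hε : ∀ n : ℕ, 0 < m / 2 * (1 / ((n : ℝ) + 1)) := fun n => by positivity
  have key := fun n : ℕ => approx_eigen C hCcl h0C hadd hCsm hCpt U hUo hUb hU0 T hBne
    (hTc.mono hBsub) A hA hTA hAC hA0 _ (hε n)
  choose x hxB l hl0 y hy hxy using key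
  obtain ⟨R, hR⟩ := hUb.closure.exists_norm_le
  have hym : ∀ n, m / 2 ≤ ‖y n‖ := by
    intro n
    have h1 := hmle _ (hxB n)
    have h2 := norm_sub_norm_le (T (x n)) (y n)
    rw [norm_sub_rev] at h2
    have h3 : m / 2 * (1 / ((n : ℝ) + 1)) ≤ m / 2 := by
      apply mul_le_of_le_one_right (by positivity)
      rw [div_le_one (by positivity)]
      linarith [(Nat.cast_nonneg n : (0:ℝ) ≤ n)]
    linarith [hy n]
  have hlR : ∀ n, l n ∈ Icc 0 (R / (m / 2)) := by
    intro n
    refine ⟨hl0 n, ?_⟩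
    rw [le_div_iff₀ (by positivity)]
    have h1 := hR _ (hBsub (hxB n)).2
    rw [hxy n, norm_smul, Real.norm_of_nonneg (hl0 n)] at h1
    exact (mul_le_mul_of_nonneg_left (hym n) (hl0 n)).trans h1
  obtain ⟨⟨l0, z⟩, -, ψ, hψ, hlim⟩ := (isCompact_Icc.prod hA).tendsto_subseq
    (x := fun n => (l n, T (x n))) (fun n => ⟨hlR n, hTA _ (hxB n)⟩)
  have hl : Filter.Tendsto (fun n => l (ψ n)) Filter.atTop (nhds l0) :=
    (continuous_fst.tendsto _).comp hlim
  have hz : Filter.Tendsto (fun n => T (x (ψ n))) Filter.atTop (nhds z) :=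
    (continuous_snd.tendsto _).comp hlim
  have hlim0 : Filter.Tendsto (fun n : ℕ => m / 2 * (1 / ((ψ n : ℝ) + 1))) Filter.atTop (nhds 0) := by
    have := (tendsto_one_div_add_atTop_nhds_zero_nat (𝕜 := ℝ)).const_mul (m / 2)
    rw [mul_zero] at this
    exact this.comp hψ.tendsto_atTop
  have hyz : Filter.Tendsto (fun n => y (ψ n)) Filter.atTop (nhds z) := by
    have h1 : Filter.Tendsto (fun n => y (ψ n) - T (x (ψ n))) Filter.atTop (nhds 0) :=
      squeeze_zero_norm (fun n => hy (ψ n)) hlim0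
    simpa using h1.add hz
  have hx : Filter.Tendsto (fun n => x (ψ n)) Filter.atTop (nhds (l0 • z)) :=
    (hl.smul hyz).congr fun n => (hxy (ψ n)).symm
  have hx0B : l0 • z ∈ B := hBcl.mem_of_tendsto hx (Filter.Eventually.of_forall fun n => hxB _)
  have hTz : T (l0 • z) = z := by
    refine tendsto_nhds_unique ?_ hz
    exact ((hTc.mono hBsub) _ hx0B).tendsto.comp (tendsto_nhdsWithin_iff.2
      ⟨hx, Filter.Eventually.of_forall fun n => hxB _⟩)
  refine ⟨l0, ?_, l0 • z, hx0B, by rw [hTz]⟩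
  have hl00 : 0 ≤ l0 := ge_of_tendsto' hl fun n => hl0 _
  refine lt_of_le_of_ne hl00 ?_
  rintro rfl
  rw [zero_smul] at hx0B
  have := hx0B.2
  rw [hUo.frontier_eq] at this
  exact this.2 hU0
end

section
/- (Existence, Case 1) Suppose β > max{β_K, β_γ} and let ρ > 0. Set σ₁ = min{σ_{1,γ}, c_{1,K}, 1}, where c_{1,K} = (βΓ(α) − (1−η)^{α−1})/(βΓ(α) + η^{α−1}) and σ_{1,γ} = (β + (η−1)Γ(3−α))/(β + ηΓ(3−α)). Assume: (i) there exists a continuous δ : [0,1] → [0,∞) with f(t,u) ≥ δ(t) for all (t,u) ∈ [0,1]×[σ₁ρ, ρ]; (ii) there exist η₁, η₂ ≥ 0 with H₁[u] ≥ η₁ and H₂[u] ≥ η₂ for every u ∈ C([0,1],ℝ) satisfying min_{t∈[0,1]} u(t) ≥ σ₁‖u‖_∞ and ‖u‖_∞ = ρ; (iii) γ(0)·η₁ + η₂ + ∫₀¹ K(0,s)δ(s) ds > 0. Then there exist λ_ρ > 0 and u_ρ ∈ C([0,1],ℝ) with ‖u_ρ‖_∞ = ρ such that u_ρ = λ_ρ·T(u_ρ)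 and σ₁ρ ≤ u_ρ(t) ≤ ρ for every t ∈ [0,1]. -/
open Set MeasureTheory

/-- The Green's function `K(t,s) = β + ((η−s)^{α−1}/Γ(α))·χ_{[0,η]}(s) −
((t−s)^{α−1}/Γ(α))·χ_{[0,t]}(s)`. -/
noncomputable def Kker (α η β t s : ℝ) : ℝ :=
  β + (Set.Icc (0:ℝ) η).indicator (fun x => (η - x) ^ (α - 1) / Real.Gamma α) s
    - (Set.Icc (0:ℝ) t).indicator (fun x => (t - x) ^ (α - 1) / Real.Gamma α) s

/-- The function `γ(t) = β/Γ(3−α) + η − t`. -/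
noncomputable def gam (α η β t : ℝ) : ℝ := β / Real.Gamma (3 - α) + η - t

/-- `C([0,1],ℝ)` with the supremum norm. -/
abbrev CI := ContinuousMap (Set.Icc (0:ℝ) 1) ℝ


section Brouwer
set_option linter.unusedSectionVars false
variable {E : Type*} [NormedAddCommGroup E] [InnerProductSpace ℝ E] [FiniteDimensional ℝ E]

lemma bw_det_poly (A : E →L[ℝ] E) : ∃ p : Polynomial ℝ, p.natDegree ≤ Module.finrank ℝ E ∧
    ∀ t : ℝ, p.eval t = (ContinuousLinearMap.id ℝ E + t • A).det := by
  classical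
  let b := Module.finBasis ℝ E
  let M := LinearMap.toMatrix b b (A : E →ₗ[ℝ] E)
  refine ⟨Matrix.det ((Polynomial.X : Polynomial ℝ) • M.map Polynomial.C +
    (1 : Matrix _ _ ℝ).map Polynomial.C), ?_, ?_⟩
  · simpa using Polynomial.natDegree_det_X_add_C_le M 1
  · intro t
    rw [← Polynomial.coe_evalRingHom, RingHom.map_det]
    have : ((ContinuousLinearMap.id ℝ E + t • A).det : ℝ) = LinearMap.det ((LinearMap.id : E →ₗ[ℝ] E) + t • (A : E →ₗ[ℝ] E)) := rfl
    rw [this, ← LinearMap.det_toMatrix b]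
    congr 1
    rw [map_add (LinearMap.toMatrix b b), map_smul (LinearMap.toMatrix b b), LinearMap.toMatrix_id]
    ext i j
    simp [M, Matrix.one_apply, apply_ite, add_comm]
    ring

lemma bw_det_pos (A : E →L[ℝ] E) (t : ℝ) (ht : 0 ≤ t) (h : t * ‖A‖ < 1) :
    0 < (ContinuousLinearMap.id ℝ E + t • A).det := by
  have hne : ∀ s ∈ Icc 0 t, (ContinuousLinearMap.id ℝ E + s • A).det ≠ 0 := by
    intro s hs h0
    have h0' : LinearMap.det ((ContinuousLinearMap.id ℝ E + s • A : E →L[ℝ] E) : E →ₗ[ℝ] E) = 0 := h0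
    have hk := LinearMap.bot_lt_ker_of_det_eq_zero h0'
    obtain ⟨v, hv, hv0⟩ := Submodule.exists_mem_ne_zero_of_ne_bot hk.ne'
    have hv' : v + s • A v = 0 := by simpa using hv
    have h1 : ‖v‖ ≤ s * ‖A‖ * ‖v‖ := by
      calc ‖v‖ = ‖s • A v‖ := by rw [← norm_neg (s • A v), ← eq_neg_of_add_eq_zero_left hv']
        _ = s * ‖A v‖ := by rw [norm_smul, Real.norm_of_nonneg hs.1]
        _ ≤ s * (‖A‖ * ‖v‖) := by gcongr; exact hs.1; exact A.le_opNorm v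
        _ = _ := by ring
    have h2 : s * ‖A‖ ≤ t * ‖A‖ := by gcongr; exact hs.2
    have h3 : 0 < ‖v‖ := norm_pos_iff.2 hv0
    nlinarith
  by_contra hneg
  push Not at hneg
  obtain ⟨p, -, hp⟩ := bw_det_poly A
  have hc : ContinuousOn (fun s => p.eval s) (Icc 0 t) := p.continuous.continuousOn
  have := intermediate_value_Icc' ht hc
  have h0 : p.eval 0 = 1 := by rw [hp]; simp [ContinuousLinearMap.det]
  obtain ⟨s, hs, hs0⟩ := this (show (0:ℝ) ∈ Icc (p.eval t) (p.eval 0) from ⟨by rw [hp]; exact hneg, by rw [h0]; norm_num⟩)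
  exact hne s hs (by rw [← hp]; exact hs0)

/-- extension by zero of a Lipschitz function vanishing on the sphere. -/
lemma bw_ext_lip (g : E → E) (K : NNReal) (hg : LipschitzOnWith K g (Metric.closedBall 0 1))
    (h0 : ∀ x, ‖x‖ = 1 → g x = 0) :
    LipschitzWith K ((Metric.closedBall (0:E) 1).indicator g) := by
  have key : ∀ x y : E, ‖x‖ ≤ 1 → 1 < ‖y‖ → ‖g x‖ ≤ K * ‖x - y‖ := by
    intro x y hx hy
    have hc : ContinuousOn (fun s : ℝ => ‖x + s • (y - x)‖) (Icc 0 1) := by fun_prop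
    obtain ⟨s, hs, hs1⟩ := intermediate_value_Icc zero_le_one hc
      (show (1:ℝ) ∈ _ from ⟨by simpa using hx, by simpa using hy.le⟩)
    have hs1' : ‖x + s • (y - x)‖ = 1 := hs1
    have := hg.dist_le_mul x (by simpa using hx) (x + s • (y - x)) (by simp [hs1'])
    rw [h0 _ hs1', dist_zero_right, dist_eq_norm] at this
    refine this.trans ?_
    gcongr
    have e : x - (x + s • (y - x)) = s • (x - y) := by module
    rw [e, norm_smul, Real.norm_of_nonneg hs.1]
    nlinarith [norm_nonneg (x - y), hs.2]
  refine LipschitzWith.of_dist_le_mul fun x y => ?_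
  by_cases hx : x ∈ Metric.closedBall (0:E) 1 <;> by_cases hy : y ∈ Metric.closedBall (0:E) 1
  · simpa [indicator_of_mem hx, indicator_of_mem hy] using hg.dist_le_mul x hx y hy
  · rw [indicator_of_mem hx, indicator_of_notMem hy, dist_zero_right, dist_eq_norm]
    exact key x y (by simpa using hx) (by simpa using hy)
  · rw [indicator_of_mem hy, indicator_of_notMem hx, dist_zero_left, dist_comm, dist_eq_norm]
    exact key y x (by simpa using hy) (by simpa using hx)
  · rw [indicator_of_notMem hx, indicator_of_notMem hy]; simp; positivity

/-- the small perturbation maps the open ball bijectively to itself -/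
lemma bw_bij (r : E → E) (K : NNReal)
    (hK : LipschitzOnWith K (fun x => r x - x) (Metric.closedBall 0 1))
    (hr1 : ∀ x, ‖x‖ ≤ 1 → ‖r x‖ = 1) (hrid : ∀ x, ‖x‖ = 1 → r x = x)
    (t : ℝ) (ht0 : 0 < t) (ht1 : t ≤ 1) (htK : t * K < 1) :
    InjOn (fun x => x + t • (r x - x)) (Metric.ball 0 1) ∧
    (fun x => x + t • (r x - x)) '' (Metric.ball 0 1) = Metric.ball 0 1 := by
  set G := (Metric.closedBall (0:E) 1).indicator (fun x => r x - x) with hG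
  have hGl : LipschitzWith K G := bw_ext_lip _ K hK (fun x hx => by simp [hrid x hx])
  have hGin : ∀ x, ‖x‖ ≤ 1 → G x = r x - x := fun x hx => indicator_of_mem (by simpa using hx) _
  have hGout : ∀ x, 1 ≤ ‖x‖ → G x = 0 := by
    intro x hx
    rcases hx.eq_or_lt with h | h
    · rw [hGin x h.symm.le, hrid x h.symm, sub_self]
    · exact indicator_of_notMem (by simpa using h) _
  have hinj : ∀ x y, x + t • G x = y + t • G y → x = y := by
    intro x y hxy
    have e : x - y = t • (G y - G x) := by
      have h := sub_eq_zero.2 hxy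
      rw [← sub_eq_zero, ← h]; module
    have h1 : ‖x - y‖ ≤ t * K * ‖x - y‖ := by
      calc ‖x - y‖ = ‖t • (G y - G x)‖ := by rw [← e]
        _ = t * ‖G y - G x‖ := by rw [norm_smul, Real.norm_of_nonneg ht0.le]
        _ ≤ t * (K * ‖x - y‖) := by
            gcongr
            have := hGl.dist_le_mul y x
            rwa [dist_eq_norm, dist_comm, dist_eq_norm] at this
        _ = _ := by ring
    by_contra hne
    have : 0 < ‖x - y‖ := norm_pos_iff.2 (sub_ne_zero.2 hne)
    nlinarith
  have hsurj : ∀ y, ∃ x, x + t • G x = y := by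
    intro y
    have hc : ContractingWith (Real.toNNReal t * K) (fun x => y - t • G x) := by
      refine ⟨by rw [← NNReal.coe_lt_coe]; simpa [ht0.le] using htK, LipschitzWith.of_dist_le_mul fun a b => ?_⟩
      rw [dist_sub_left, dist_smul₀, Real.norm_of_nonneg ht0.le]
      have := hGl.dist_le_mul a b
      calc t * dist (G a) (G b) ≤ t * (K * dist a b) := by gcongr
        _ = _ := by simp [mul_assoc, ht0.le]
    refine ⟨hc.fixedPoint, ?_⟩
    have := hc.fixedPoint_isFixedPt
    have h2 : y - t • G hc.fixedPoint = hc.fixedPoint := this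
    nth_rewrite 1 [← h2]; simp
  have hle : ∀ x, ‖x‖ ≤ 1 → ‖x + t • (r x - x)‖ ≤ 1 := by
    intro x hx
    have e : x + t • (r x - x) = (1 - t) • x + t • r x := by module
    rw [e]
    calc _ ≤ ‖(1 - t) • x‖ + ‖t • r x‖ := norm_add_le _ _
      _ = (1 - t) * ‖x‖ + t * 1 := by
        rw [norm_smul, norm_smul, hr1 x hx, Real.norm_of_nonneg ht0.le, Real.norm_of_nonneg (by linarith)]
      _ ≤ 1 := by nlinarith
  constructor
  · intro x hx y hy hxy
    have hx' : ‖x‖ < 1 := by simpa using hx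
    have hy' : ‖y‖ < 1 := by simpa using hy
    apply hinj
    rw [hGin x hx'.le, hGin y hy'.le]; exact hxy
  · ext y
    constructor
    · rintro ⟨x, hx, rfl⟩
      have hx' : ‖x‖ < 1 := by simpa using hx
      have h1 := hle x hx'.le
      rw [mem_ball_zero_iff]
      rcases h1.eq_or_lt with h | h
      · exfalso
        have : x = x + t • (r x - x) := by
          apply hinj
          rw [hGout (x + t • (r x - x)) h.symm.le, hGin x hx'.le]; simp
        rw [← this] at h
        linarith
      · exact h
    · intro hy
      have hy' : ‖y‖ < 1 := by simpa using hy
      obtain ⟨x, hx⟩ := hsurj y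
      have hx1 : ‖x‖ < 1 := by
        by_contra hcon
        push Not at hcon
        rw [hGout x hcon, smul_zero, add_zero] at hx
        rw [hx] at hcon; linarith
      exact ⟨x, by simpa using hx1, by rw [hGin x hx1.le] at hx; exact hx⟩

variable [MeasurableSpace E] [BorelSpace E]

lemma bw_no_retraction (r : E → E) (hr : ∀ x, ‖x‖ ≤ 1 → ContDiffAt ℝ 1 r x)
    (hr1 : ∀ x, ‖x‖ ≤ 1 → ‖r x‖ = 1) (hrid : ∀ x, ‖x‖ = 1 → r x = x) : False := by
  set B := Metric.closedBall (0:E) 1 with hB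
  set U := Metric.ball (0:E) 1 with hU
  have hBc : IsCompact B := isCompact_closedBall _ _
  have hUB : U ⊆ B := Metric.ball_subset_closedBall
  have memB : ∀ {x}, x ∈ B → ‖x‖ ≤ 1 := fun h => by simpa [hB] using h
  have memU : ∀ {x}, x ∈ U → ‖x‖ < 1 := fun h => by simpa [hU] using h
  have hcd : ContDiffOn ℝ 1 (fun x => r x - x) B := fun x hx =>
    ((hr x (memB hx)).sub contDiffAt_id).contDiffWithinAt
  obtain ⟨K, hK⟩ := hcd.exists_lipschitzOnWith one_ne_zero (convex_closedBall _ _) hBc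
  let A : E → E →L[ℝ] E := fun x => fderiv ℝ r x - ContinuousLinearMap.id ℝ E
  have hAc : ContinuousOn A B := by
    intro x hx
    have : ContDiffAt ℝ 0 (fderiv ℝ r) x := (hr x (memB hx)).fderiv_right (by norm_num)
    exact (this.continuousAt.sub continuousAt_const).continuousWithinAt
  obtain ⟨C, hC⟩ := hBc.exists_bound_of_continuousOn hAc
  -- the threshold
  obtain ⟨t0, ht0, ht01, ht0K, ht0C⟩ : ∃ t0 : ℝ, 0 < t0 ∧ t0 ≤ 1 ∧ t0 * K < 1 ∧ t0 * |C| < 1 := by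
    refine ⟨1 / (1 + K + |C|), by positivity, ?_, ?_, ?_⟩
    · rw [div_le_one (by positivity)]
      have := abs_nonneg C; have := K.2; simp only [NNReal.val_eq_coe] at this; linarith
    · rw [div_mul_eq_mul_div, div_lt_one (by positivity)]
      have := abs_nonneg C; linarith
    · rw [div_mul_eq_mul_div, div_lt_one (by positivity)]
      have := K.2; simp only [NNReal.val_eq_coe] at this; linarith
  have hdetc : ∀ t : ℝ, ContinuousOn (fun x => (ContinuousLinearMap.id ℝ E + t • A x).det) B := by
    intro t
    exact ContinuousLinearMap.continuous_det.comp_continuousOn (continuousOn_const.add (hAc.const_smul t))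
  have hint : ∀ t : ℝ, IntegrableOn (fun x => (ContinuousLinearMap.id ℝ E + t • A x).det) U volume :=
    fun t => ((hdetc t).integrableOn_compact hBc).mono_set hUB
  have hvol : ∀ t : ℝ, 0 < t → t ≤ t0 →
      ∫ x in U, (ContinuousLinearMap.id ℝ E + t • A x).det = (volume U).toReal := by
    intro t ht htt
    have htK : t * K < 1 := lt_of_le_of_lt (by gcongr) ht0K
    have htC : t * |C| < 1 := lt_of_le_of_lt (by gcongr) ht0C
    obtain ⟨hinj, him⟩ := bw_bij r K hK hr1 hrid t ht (htt.trans ht01) htK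
    have hd : ∀ x ∈ U, HasFDerivWithinAt (fun x => x + t • (r x - x))
        (ContinuousLinearMap.id ℝ E + t • A x) U x := by
      intro x hx
      have h1 : HasFDerivAt r (fderiv ℝ r x) x :=
        ((hr x (memU hx).le).differentiableAt one_ne_zero).hasFDerivAt
      exact ((hasFDerivAt_id x).add ((h1.sub (hasFDerivAt_id x)).const_smul t)).hasFDerivWithinAt
    have := integral_image_eq_integral_abs_det_fderiv_smul volume
      (measurableSet_ball) hd hinj (fun _ => (1:ℝ))
    rw [him] at this
    simp only [smul_eq_mul, mul_one, integral_const] at this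
    rw [measureReal_restrict_apply_univ] at this
    change (volume.real U) = _ at this
    rw [← measureReal_def, this]
    refine setIntegral_congr_fun measurableSet_ball fun x hx => ?_
    refine (abs_of_pos (bw_det_pos _ t ht.le ?_)).symm
    refine lt_of_le_of_lt ?_ htC
    gcongr
    exact (hC x (hUB hx)).trans (le_abs_self C)
  have hdet1 : ∀ x ∈ U, (ContinuousLinearMap.id ℝ E + (1:ℝ) • A x).det = 0 := by
    intro x hx
    have e : ContinuousLinearMap.id ℝ E + (1:ℝ) • A x = fderiv ℝ r x := by simp [A]
    rw [e]
    by_contra hne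
    have h1 : HasFDerivAt r (fderiv ℝ r x) x :=
        ((hr x (memU hx).le).differentiableAt one_ne_zero).hasFDerivAt
    have h2 := h1.norm_sq
    have h3 : HasFDerivAt (fun y => ‖r y‖ ^ 2) (0 : E →L[ℝ] ℝ) x := by
      refine (hasFDerivAt_const (1:ℝ) x).congr_of_eventuallyEq ?_
      filter_upwards [Metric.isOpen_ball.mem_nhds hx] with y hy
      rw [hr1 y (memU hy).le]; norm_num
    have h4 := h2.unique h3
    let e := LinearMap.equivOfDetNeZero ((fderiv ℝ r x : E →L[ℝ] E) : E →ₗ[ℝ] E) hne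
    obtain ⟨v, hv⟩ := e.surjective (r x)
    have hv' : fderiv ℝ r x v = r x := hv
    have h5 := DFunLike.congr_fun h4 v
    simp [hv', hr1 x (memU hx).le] at h5
  choose p hpd hp using fun x => bw_det_poly (A x)
  set n := Module.finrank ℝ E with hn
  let s := Finset.range (n + 1)
  let v : ℕ → ℝ := fun i => t0 / (i + 1)
  have hvs : Set.InjOn v s := by
    intro i _ j _ hij
    have : t0 / ((i:ℝ) + 1) = t0 / (j + 1) := hij
    have h2 : (i:ℝ) = j := by
      field_simp at this
      linarith
    exact_mod_cast h2
  have hv0 : ∀ i, 0 < v i := fun i => by simp only [v]; positivity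
  have hvt : ∀ i, v i ≤ t0 := fun i => div_le_self ht0.le (by linarith [(Nat.cast_nonneg i : (0:ℝ) ≤ i)])
  have hexp : ∀ x, (p x).eval 1 = ∑ i ∈ s, (p x).eval (v i) * (Lagrange.basis s v i).eval 1 := by
    intro x
    have hdeg : (p x).degree < (s.card : ℕ) := by
      refine lt_of_le_of_lt (Polynomial.degree_le_natDegree) ?_
      have := hpd x
      simp only [s, Finset.card_range]
      exact_mod_cast Nat.lt_succ_of_le this
    have := Lagrange.eq_interpolate hvs hdeg
    conv_lhs => rw [this]
    simp [Lagrange.interpolate_apply, Polynomial.eval_finsetSum]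
  have hsum : ∑ i ∈ s, (Lagrange.basis s v i).eval 1 = 1 := by
    rw [← Polynomial.eval_finsetSum, Lagrange.sum_basis hvs ⟨0, by simp [s]⟩]; simp
  have hfin : ∫ x in U, (p x).eval 1 = (volume U).toReal := by
    simp_rw [hexp, hp]
    rw [integral_finsetSum _ (fun i _ => (hint (v i)).mul_const _)]
    simp_rw [integral_mul_const, hvol _ (hv0 _) (hvt _)]
    rw [← Finset.mul_sum, hsum, mul_one]
  have hzero : ∫ x in U, (p x).eval 1 = 0 := by
    rw [setIntegral_congr_fun measurableSet_ball (g := fun _ => (0:ℝ))]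
    · simp
    · intro x hx
      simp only [hp]; exact hdet1 x hx
  have hpos : 0 < (volume U).toReal :=
    ENNReal.toReal_pos (Metric.measure_ball_pos _ _ one_pos).ne' measure_ball_lt_top.ne
  linarith

lemma bw_smooth (f : E → E) (hf : ContDiff ℝ 1 f) (hfB : ∀ x, ‖x‖ ≤ 1 → ‖f x‖ ≤ 1) :
    ∃ x, ‖x‖ ≤ 1 ∧ f x = x := by
  by_contra! hno
  let d : E → E := fun x => x - f x
  have hd : ContDiff ℝ 1 d := contDiff_id.sub hf
  have hd0 : ∀ x, ‖x‖ ≤ 1 → 0 < ‖d x‖ ^ 2 := fun x hx => by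
    have : d x ≠ 0 := fun h => hno x hx (sub_eq_zero.1 h).symm
    have := norm_pos_iff.2 this
    positivity
  let D : E → ℝ := fun x => inner ℝ x (d x) ^ 2 + ‖d x‖ ^ 2 * (1 - ‖x‖ ^ 2)
  have hpos1 : ∀ x, ‖x‖ = 1 → 0 < inner ℝ x (d x) := by
    intro x hx
    have h1 : inner ℝ x (d x) = 1 - inner ℝ x (f x) := by
      simp [d, inner_sub_right, hx]
    have h2 := hd0 x hx.le
    have h3 : ‖d x‖ ^ 2 = ‖x‖ ^ 2 - 2 * inner ℝ x (f x) + ‖f x‖ ^ 2 := norm_sub_sq_real _ _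
    have h4 := hfB x hx.le
    have h5 := norm_nonneg (f x)
    rw [hx] at h3
    nlinarith
  have hD : ∀ x, ‖x‖ ≤ 1 → 0 < D x := by
    intro x hx
    have h2 := hd0 x hx
    rcases hx.eq_or_lt with h | h
    · have := hpos1 x h
      simp only [D, h]; nlinarith
    · have : 0 < 1 - ‖x‖ ^ 2 := by nlinarith [norm_nonneg x]
      simp only [D]; nlinarith [sq_nonneg (inner ℝ x (d x) : ℝ), mul_pos h2 this]
  let c : E → ℝ := fun x => (-inner ℝ x (d x) + √(D x)) / ‖d x‖ ^ 2
  have hDs : ContDiff ℝ 1 D :=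
    ((contDiff_id.inner ℝ hd).pow 2).add ((hd.norm_sq ℝ).mul (contDiff_const.sub (contDiff_id.norm_sq ℝ)))
  refine bw_no_retraction (fun x => x + c x • d x) ?_ ?_ ?_
  · intro x hx
    refine contDiffAt_id.add (ContDiffAt.smul ?_ hd.contDiffAt)
    refine ContDiffAt.div ?_ (hd.norm_sq ℝ).contDiffAt (hd0 x hx).ne'
    exact ((contDiff_id.inner ℝ hd).neg).contDiffAt.add (hDs.contDiffAt.sqrt (hD x hx).ne')
  · intro x hx
    have h1 : ‖x + c x • d x‖ ^ 2 = 1 := by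
      rw [norm_add_sq_real, norm_smul, inner_smul_right, mul_pow, Real.norm_eq_abs, sq_abs]
      have hs : √(D x) ^ 2 = D x := Real.sq_sqrt (hD x hx).le
      have hN := (hd0 x hx).ne'
      have hc : c x * ‖d x‖ ^ 2 = -inner ℝ x (d x) + √(D x) := div_mul_cancel₀ _ hN
      have hDe : D x = inner ℝ x (d x) ^ 2 + ‖d x‖ ^ 2 * (1 - ‖x‖ ^ 2) := rfl
      rw [hDe] at hs
      rw [hDe] at hc
      generalize √(inner ℝ x (d x) ^ 2 + ‖d x‖ ^ 2 * (1 - ‖x‖ ^ 2)) = q at hs hc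
      apply mul_right_cancel₀ hN
      linear_combination (2 * inner ℝ x (d x) + c x * ‖d x‖ ^ 2 - inner ℝ x (d x) + q) * hc + hs
    have h2 := norm_nonneg (x + c x • d x)
    nlinarith
  · intro x hx
    have : c x = 0 := by
      have : D x = inner ℝ x (d x) ^ 2 := by simp [D, hx]
      simp only [c]
      rw [this, Real.sqrt_sq (hpos1 x hx).le]; simp
    simp [this]

theorem bw_brouwer (f : E → E) (hf : Continuous f) (hfB : ∀ x, ‖f x‖ ≤ 1) : ∃ x, f x = x := by
  obtain ⟨x, hx, hmin⟩ := (isCompact_closedBall (0:E) 1).exists_isMinOn ⟨0, by simp⟩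
    (f := fun x => ‖x - f x‖) (by fun_prop)
  refine ⟨x, ?_⟩
  have key : ∀ ε : ℝ, 0 < ε → ‖x - f x‖ ≤ 2 * ε := by
    intro ε hε
    obtain ⟨g, hg, hgf, -⟩ := hf.exists_contDiff_approx 1 (ε := fun _ => ε) continuous_const (fun _ => hε)
    have hgn : ∀ y, ‖g y‖ ≤ 1 + ε := by
      intro y
      have h1 := (hgf y).le
      rw [dist_eq_norm] at h1
      have h2 := norm_le_norm_add_norm_sub (f y) (g y)
      rw [norm_sub_rev] at h2
      linarith [hfB y]
    obtain ⟨y, hy, hyf⟩ := bw_smooth (fun y => (1 + ε)⁻¹ • g y) (hg.const_smul _) (by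
      intro y _
      rw [norm_smul, norm_inv, Real.norm_of_nonneg (by linarith), inv_mul_le_iff₀ (by linarith)]
      simpa using hgn y)
    have h1 : g y = (1 + ε) • y := by
      have h1e : (1 + ε) ≠ 0 := by linarith
      conv_rhs => rw [← hyf]
      rw [smul_smul, mul_inv_cancel₀ h1e, one_smul]
    have h2 : ‖x - f x‖ ≤ ‖y - f y‖ := hmin (show y ∈ Metric.closedBall (0:E) 1 by simpa using hy)
    have h3 : y - f y = (g y - f y) - ε • y := by rw [h1]; module
    have h4 : ‖y - f y‖ ≤ ‖g y - f y‖ + ‖ε • y‖ := by rw [h3]; exact norm_sub_le _ _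
    have h5 := (hgf y).le
    rw [dist_eq_norm] at h5
    rw [norm_smul, Real.norm_of_nonneg hε.le] at h4
    nlinarith
  have h0 : ‖x - f x‖ ≤ 0 := by
    refine le_of_forall_pos_le_add fun ε hε => ?_
    have := key (ε / 2) (by positivity)
    linarith
  exact (sub_eq_zero.1 (norm_le_zero_iff.1 h0)).symm

end Brouwer

theorem bw_schauder {X : Type*} [NormedAddCommGroup X] [NormedSpace ℝ X] (F : X → X)
    (hF : Continuous F) (K : Set X) (hK : IsCompact K) (hFK : ∀ x, F x ∈ K) : ∃ x, F x = x := by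
  classical
  have approx : ∀ ε : ℝ, 0 < ε → ∃ u, ‖u - F u‖ ≤ ε := by
    intro ε hε
    obtain ⟨N, -, hNf, hcov⟩ := hK.finite_cover_balls hε
    have : Fintype N := hNf.fintype
    let φ : N → X → ℝ := fun i y => max 0 (ε - ‖y - i‖)
    have hφ0 : ∀ i y, 0 ≤ φ i y := fun i y => le_max_left _ _
    let S : X → ℝ := fun y => ∑ i, φ i y
    have hS : ∀ y ∈ K, 0 < S y := by
      intro y hy
      obtain ⟨i, hi, hyi⟩ := mem_iUnion₂.1 (hcov hy)
      refine Finset.sum_pos' (fun i _ => hφ0 i y) ⟨⟨i, hi⟩, Finset.mem_univ _, ?_⟩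
      rw [Metric.mem_ball, dist_eq_norm] at hyi
      exact lt_max_of_lt_right (by simpa using hyi)
    let L : EuclideanSpace ℝ N → X := fun a => ∑ i, a i • (i : X)
    have hL : Continuous L := by
      simp only [L]; fun_prop
    let w : EuclideanSpace ℝ N → EuclideanSpace ℝ N := fun a =>
      WithLp.toLp 2 (fun i => φ i (F (L a)) / S (F (L a)))
    have hφc : ∀ i, Continuous (φ i) := fun i => by simp only [φ]; fun_prop
    have hSc : Continuous S := continuous_finsetSum _ fun i _ => hφc i
    have hw : Continuous w := by
      refine (PiLp.continuous_toLp 2 _).comp (continuous_pi fun i => ?_)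
      exact ((hφc i).comp (hF.comp hL)).div (hSc.comp (hF.comp hL)) fun a => (hS _ (hFK _)).ne'
    have hsum : ∀ a, ∑ i, w a i = 1 := by
      intro a
      change ∑ i, φ i (F (L a)) / S (F (L a)) = 1
      rw [← Finset.sum_div]
      exact div_self (hS _ (hFK _)).ne'
    have hw0 : ∀ a i, 0 ≤ w a i := fun a i => div_nonneg (hφ0 _ _) (hS _ (hFK _)).le
    have hw1 : ∀ a, ‖w a‖ ≤ 1 := by
      intro a
      rw [EuclideanSpace.norm_eq, Real.sqrt_le_one, ← hsum a]
      refine Finset.sum_le_sum fun i _ => ?_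
      have h1 : w a i ≤ 1 := by
        rw [← hsum a]
        exact Finset.single_le_sum (f := fun i => w a i) (fun i _ => hw0 a i) (Finset.mem_univ i)
      rw [Real.norm_eq_abs, sq_abs]
      nlinarith [hw0 a i]
    obtain ⟨a, ha⟩ := bw_brouwer w hw hw1
    refine ⟨L a, ?_⟩
    have hs1 : ∑ i, a i = 1 := by have := hsum a; rwa [ha] at this
    have e : L a - F (L a) = ∑ i, a i • ((i : X) - F (L a)) := by
      simp only [smul_sub, Finset.sum_sub_distrib, ← Finset.sum_smul, hs1, one_smul, L]
    rw [e]
    calc _ ≤ ∑ i, ‖a i • ((i : X) - F (L a))‖ := norm_sum_le _ _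
      _ ≤ ∑ i, a i * ε := by
        refine Finset.sum_le_sum fun i _ => ?_
        have h0 : 0 ≤ a i := by rw [← ha]; exact hw0 a i
        rw [norm_smul, Real.norm_of_nonneg h0]
        by_cases hi : ‖(i : X) - F (L a)‖ ≤ ε
        · gcongr
        · have : a i = 0 := by
            rw [← ha]
            change φ i (F (L a)) / S (F (L a)) = 0
            rw [div_eq_zero_iff]; left
            refine max_eq_left ?_
            rw [norm_sub_rev]; linarith
          simp [this]
      _ = ε := by rw [← Finset.sum_mul, hs1, one_mul]
  choose u hu using fun n : ℕ => approx (1 / ((n:ℝ) + 1)) (by positivity)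
  obtain ⟨v, -, ψ, hψ, hlim⟩ := hK.tendsto_subseq (x := fun n => F (u n)) (fun n => hFK _)
  have h0 : Filter.Tendsto (fun n => u (ψ n) - F (u (ψ n))) Filter.atTop (nhds 0) := by
    have : Filter.Tendsto (fun n => u n - F (u n)) Filter.atTop (nhds 0) :=
      squeeze_zero_norm hu tendsto_one_div_add_atTop_nhds_zero_nat
    exact this.comp hψ.tendsto_atTop
  have h1 : Filter.Tendsto (fun n => u (ψ n)) Filter.atTop (nhds v) := by
    have := h0.add hlim
    simpa using this
  exact ⟨v, tendsto_nhds_unique ((hF.tendsto v).comp h1) hlim⟩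

lemma bw_compact (R : ℝ) (b : ℝ → ℝ) (hb : Filter.Tendsto b (nhds 0) (nhds 0)) :
    IsCompact {g : CI | (∀ t, |g t| ≤ R) ∧ ∀ t t', dist (g t) (g t') ≤ b (dist t t')} := by
  apply ArzelaAscoli.isCompact_of_equicontinuous
  · have e : ContinuousMap.toFun '' {g : CI | (∀ t, |g t| ≤ R) ∧ ∀ t t', dist (g t) (g t') ≤ b (dist t t')}
        = {h : Icc (0:ℝ) 1 → ℝ | (∀ t, |h t| ≤ R) ∧ ∀ t t', dist (h t) (h t') ≤ b (dist t t')} := by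
      ext h
      constructor
      · rintro ⟨g, hg, rfl⟩; exact hg
      · intro hh
        refine ⟨⟨h, ?_⟩, hh, rfl⟩
        rw [continuous_iff_continuousAt]
        intro t
        rw [ContinuousAt, tendsto_iff_dist_tendsto_zero]
        refine squeeze_zero (fun _ => dist_nonneg) (fun t' => hh.2 t' t) ?_
        refine hb.comp ?_
        have : Continuous fun t' : Icc (0:ℝ) 1 => dist t' t := by fun_prop
        simpa using this.tendsto t
    rw [e]
    refine IsCompact.of_isClosed_subset (isCompact_univ_pi (fun _ : Icc (0:ℝ) 1 => isCompact_Icc (a := -R) (b := R))) ?_ ?_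
    · rw [Set.ofPred_and]
      simp only [Set.ofPred_forall]
      refine IsClosed.inter (isClosed_iInter fun t => ?_) (isClosed_iInter fun t => isClosed_iInter fun t' => ?_)
      · exact isClosed_le (by fun_prop) continuous_const
      · exact isClosed_le (by fun_prop) continuous_const
    · intro h hh t _
      exact abs_le.1 (hh.1 t)
  · refine Metric.equicontinuous_of_continuity_modulus b hb _ ?_
    rintro t t' ⟨g, hg⟩
    exact hg.2 t t'

/-- continuous version of the kernel -/
noncomputable def bwK (α η β t s : ℝ) : ℝ :=
  β + (max (η - s) 0) ^ (α - 1) / Real.Gamma α - (max (t - s) 0) ^ (α - 1) / Real.Gamma α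

lemma bwK_eq (α η β t s : ℝ) (hα : 1 < α) (hs : 0 ≤ s) : Kker α η β t s = bwK α η β t s := by
  have key : ∀ c : ℝ, (Set.Icc (0:ℝ) c).indicator (fun x => (c - x) ^ (α - 1) / Real.Gamma α) s
      = (max (c - s) 0) ^ (α - 1) / Real.Gamma α := by
    intro c
    by_cases h : s ≤ c
    · rw [indicator_of_mem (show s ∈ Set.Icc (0:ℝ) c from ⟨hs, h⟩), max_eq_left (by linarith)]
    · rw [indicator_of_notMem (fun h' => h h'.2), max_eq_right (by linarith),
        Real.zero_rpow (by linarith), zero_div]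
  simp only [Kker, bwK, key]

lemma bwK_cont (α η β : ℝ) (hα : 1 < α) : Continuous fun p : ℝ × ℝ => bwK α η β p.1 p.2 := by
  have hr : Continuous fun x : ℝ => x ^ (α - 1) := Real.continuous_rpow_const (by linarith)
  have h1 : Continuous fun p : ℝ × ℝ => (max (η - p.2) 0) ^ (α - 1) := hr.comp (by fun_prop)
  have h2 : Continuous fun p : ℝ × ℝ => (max (p.1 - p.2) 0) ^ (α - 1) := hr.comp (by fun_prop)
  simp only [bwK]
  fun_prop

lemma bwK_zero (α η β s : ℝ) (hα : 1 < α) (hs : 0 ≤ s) :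
    bwK α η β 0 s = β + (max (η - s) 0) ^ (α - 1) / Real.Gamma α := by
  rw [bwK, max_eq_right (show 0 - s ≤ 0 by linarith), Real.zero_rpow (by linarith)]; simp

lemma bwK_le (α η β t s : ℝ) (hα : 1 < α) (hs : 0 ≤ s) : bwK α η β t s ≤ bwK α η β 0 s := by
  rw [bwK_zero α η β s hα hs, bwK]
  have : 0 < Real.Gamma α := Real.Gamma_pos_of_pos (by linarith)
  have : 0 ≤ (max (t - s) 0) ^ (α - 1) / Real.Gamma α := by positivity
  linarith

lemma bwK_zero_nonneg (α η β s : ℝ) (hα : 1 < α) (hβ : 0 < β) (hs : 0 ≤ s) : 0 ≤ bwK α η β 0 s := by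
  rw [bwK_zero α η β s hα hs]
  have : 0 < Real.Gamma α := Real.Gamma_pos_of_pos (by linarith)
  positivity

lemma bwK_ge (α η β t s : ℝ) (hα : 1 < α) (hα2 : α ≤ 2) (hη0 : 0 < η) (hη1 : η < 1)
    (hβ0 : 0 < β) (hβ : (1 - η) ^ (α - 1) / Real.Gamma α < β) (hs : 0 ≤ s) (hs1 : s ≤ 1)
    (ht : t ≤ 1) :
    ((β * Real.Gamma α - (1 - η) ^ (α - 1)) / (β * Real.Gamma α + η ^ (α - 1))) * bwK α η β 0 s
      ≤ bwK α η β t s := by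
  have hG : 0 < Real.Gamma α := Real.Gamma_pos_of_pos (by linarith)
  have ha0 : 0 ≤ α - 1 := by linarith
  have ha1 : α - 1 ≤ 1 := by linarith
  have hb : 0 < β * Real.Gamma α - (1 - η) ^ (α - 1) := by
    rw [div_lt_iff₀ hG] at hβ; linarith
  have hd : 0 < β * Real.Gamma α + η ^ (α - 1) := by positivity
  rw [bwK_zero α η β s hα hs, bwK]
  have h1 : (max (t - s) 0) ^ (α - 1) ≤ (max (η - s) 0) ^ (α - 1) + (1 - η) ^ (α - 1) := by
    calc (max (t - s) 0) ^ (α - 1) ≤ (max (η - s) 0 + (1 - η)) ^ (α - 1) := by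
          apply Real.rpow_le_rpow (le_max_right _ _) _ ha0
          apply max_le
          · linarith [le_max_left (η - s) 0]
          · linarith [le_max_right (η - s) 0]
      _ ≤ _ := Real.rpow_add_le_add_rpow (le_max_right _ _) (by linarith) ha0 ha1
  have h2 : (max (η - s) 0) ^ (α - 1) ≤ η ^ (α - 1) := by
    apply Real.rpow_le_rpow (le_max_right _ _) _ ha0
    exact max_le (by linarith) hη0.le
  generalize (max (η - s) 0) ^ (α - 1) = x at *
  generalize (max (t - s) 0) ^ (α - 1) = y at *
  generalize η ^ (α - 1) = z at *
  generalize (1 - η) ^ (α - 1) = q at *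
  generalize Real.Gamma α = G at *
  have e1 : β + x / G = (β * G + x) / G := by field_simp
  have e2 : β + x / G - y / G = (β * G + x - y) / G := by field_simp
  rw [e2, e1, ← mul_div_assoc]
  apply div_le_div_of_nonneg_right _ hG.le
  rw [div_mul_eq_mul_div, div_le_iff₀ hd]
  nlinarith

lemma bwK_holder (α η β t t' s : ℝ) (hα : 1 < α) (hα2 : α ≤ 2) :
    |bwK α η β t s - bwK α η β t' s| ≤ |t - t'| ^ (α - 1) / Real.Gamma α := by
  have hG : 0 < Real.Gamma α := Real.Gamma_pos_of_pos (by linarith)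
  have ha0 : 0 ≤ α - 1 := by linarith
  have ha1 : α - 1 ≤ 1 := by linarith
  have key : ∀ t t' : ℝ, (max (t - s) 0) ^ (α - 1) - (max (t' - s) 0) ^ (α - 1) ≤ |t - t'| ^ (α - 1) := by
    intro t t'
    have : (max (t - s) 0) ^ (α - 1) ≤ (max (t' - s) 0) ^ (α - 1) + |t - t'| ^ (α - 1) := by
      calc (max (t - s) 0) ^ (α - 1) ≤ (max (t' - s) 0 + |t - t'|) ^ (α - 1) := by
            apply Real.rpow_le_rpow (le_max_right _ _) _ ha0
            apply max_le
            · linarith [le_max_left (t' - s) 0, le_abs_self (t - t')]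
            · positivity
        _ ≤ _ := Real.rpow_add_le_add_rpow (le_max_right _ _) (abs_nonneg _) ha0 ha1
    linarith
  have e : bwK α η β t s - bwK α η β t' s
      = ((max (t' - s) 0) ^ (α - 1) - (max (t - s) 0) ^ (α - 1)) / Real.Gamma α := by
    simp only [bwK]; ring
  rw [e, abs_div, abs_of_pos hG]
  gcongr
  refine abs_le.2 ⟨?_, ?_⟩
  · linarith [key t t']
  · have h := key t' t
    rw [abs_sub_comm] at h
    linarith only [h]

/-- Existence, Case 1: if `β > max{β_K, β_γ}`, `f ≥ δ` on
`[0,1]×[σ₁ρ,ρ]`, `H₁ ≥ η₁` and `H₂ ≥ η₂` on `P_{σ₁} ∩ ∂Ω_ρ`, and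
`γ(0)η₁ + η₂ + ∫₀¹ K(0,s)δ(s) ds > 0`, then there exist `λ_ρ > 0` and `u_ρ` with
`‖u_ρ‖_∞ = ρ`, `u_ρ = λ_ρ·T(u_ρ)` and `σ₁ρ ≤ u_ρ(t) ≤ ρ` on `[0,1]`. -/
theorem stmt_16
    (α η β : ℝ) (hα1 : 1 < α) (hα2 : α ≤ 2) (hη0 : 0 < η) (hη1 : η < 1) (hβ0 : 0 < β)
    (f : ℝ → ℝ → ℝ)
    (hf : ContinuousOn (fun p : ℝ × ℝ => f p.1 p.2) (Set.Icc (0:ℝ) 1 ×ˢ Set.univ))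
    (hf0 : ∀ t ∈ Set.Icc (0:ℝ) 1, ∀ x : ℝ, 0 ≤ f t x)
    (H₁ H₂ : CI → ℝ) (hH₁c : Continuous H₁) (hH₂c : Continuous H₂)
    (hH₁0 : ∀ u, 0 ≤ H₁ u) (hH₂0 : ∀ u, 0 ≤ H₂ u)
    (hH₁b : ∀ S : Set CI, Bornology.IsBounded S → Bornology.IsBounded (H₁ '' S))
    (hH₂b : ∀ S : Set CI, Bornology.IsBounded S → Bornology.IsBounded (H₂ '' S))
    (T : CI → CI)
    (hT : ∀ (u : CI) (t : Set.Icc (0:ℝ) 1), T u t = H₁ u * gam α η β (t : ℝ) + H₂ u +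
      ∫ s in (0:ℝ)..1, Kker α η β (t : ℝ) s * f s (Set.IccExtend zero_le_one u s))
    (hβ : max ((1 - η) ^ (α - 1) / Real.Gamma α) ((1 - η) * Real.Gamma (3 - α)) < β)
    (ρ : ℝ) (hρ : 0 < ρ)
    (σ₁ : ℝ)
    (hσ₁ : σ₁ = min ((β + (η - 1) * Real.Gamma (3 - α)) / (β + η * Real.Gamma (3 - α)))
      (min ((β * Real.Gamma α - (1 - η) ^ (α - 1)) / (β * Real.Gamma α + η ^ (α - 1))) 1))
    (δ : ℝ → ℝ) (hδc : ContinuousOn δ (Set.Icc (0:ℝ) 1))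
    (hδ0 : ∀ t ∈ Set.Icc (0:ℝ) 1, 0 ≤ δ t)
    (hfδ : ∀ t ∈ Set.Icc (0:ℝ) 1, ∀ x ∈ Set.Icc (σ₁ * ρ) ρ, δ t ≤ f t x)
    (η₁ η₂ : ℝ) (hη₁ : 0 ≤ η₁) (hη₂ : 0 ≤ η₂)
    (hH : ∀ u : CI, (∀ t, σ₁ * ‖u‖ ≤ u t) → ‖u‖ = ρ → η₁ ≤ H₁ u ∧ η₂ ≤ H₂ u)
    (hpos : 0 < gam α η β 0 * η₁ + η₂ + ∫ s in (0:ℝ)..1, Kker α η β 0 s * δ s) :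
    ∃ lam : ℝ, 0 < lam ∧ ∃ u : CI, ‖u‖ = ρ ∧ u = lam • T u ∧
      ∀ t, σ₁ * ρ ≤ u t ∧ u t ≤ ρ := by
  have hG : 0 < Real.Gamma α := Real.Gamma_pos_of_pos (by linarith)
  have hG3 : 0 < Real.Gamma (3 - α) := Real.Gamma_pos_of_pos (by linarith)
  have hβK := (le_max_left _ _).trans_lt hβ
  have hβg := (le_max_right _ _).trans_lt hβ
  have hdg : 0 < β + η * Real.Gamma (3 - α) := by positivity
  have hσ_le1 : σ₁ ≤ 1 := by rw [hσ₁]; exact (min_le_right _ _).trans (min_le_right _ _)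
  have hσ_pos : 0 < σ₁ := by
    rw [hσ₁]
    refine lt_min (div_pos (by linarith) hdg) (lt_min (div_pos ?_ ?_) one_pos)
    · rw [div_lt_iff₀ hG] at hβK; linarith
    · positivity
  have hσρ : σ₁ * ρ ≤ ρ := by nlinarith
  have hσρ0 : 0 < σ₁ * ρ := by positivity
  -- facts on the kernel
  have hKge : ∀ t s : ℝ, t ≤ 1 → 0 ≤ s → s ≤ 1 → σ₁ * bwK α η β 0 s ≤ bwK α η β t s := by
    intro t s ht hs hs1
    refine le_trans ?_ (bwK_ge α η β t s hα1 hα2 hη0 hη1 hβ0 hβK hs hs1 ht)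
    refine mul_le_mul_of_nonneg_right ?_ (bwK_zero_nonneg α η β s hα1 hβ0 hs)
    rw [hσ₁]; exact (min_le_right _ _).trans (min_le_left _ _)
  have hg0 : gam α η β 0 = (β + η * Real.Gamma (3 - α)) / Real.Gamma (3 - α) := by
    rw [gam]; field_simp; ring
  have hg0pos : 0 < gam α η β 0 := by rw [hg0]; positivity
  have hgle : ∀ t : ℝ, 0 ≤ t → gam α η β t ≤ gam α η β 0 := by
    intro t ht; simp only [gam]; linarith
  have hgge : ∀ t : ℝ, t ≤ 1 → σ₁ * gam α η β 0 ≤ gam α η β t := by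
    intro t ht
    have h1 : gam α η β 1 ≤ gam α η β t := by simp only [gam]; linarith
    refine le_trans ?_ h1
    have h2 : gam α η β 1 = (β + (η - 1) * Real.Gamma (3 - α)) / (β + η * Real.Gamma (3 - α)) * gam α η β 0 := by
      rw [hg0, gam]; field_simp; ring
    rw [h2]
    refine mul_le_mul_of_nonneg_right ?_ hg0pos.le
    rw [hσ₁]; exact min_le_left _ _
  -- the superposition operator
  let z0 : Set.Icc (0:ℝ) 1 := ⟨0, by simp⟩
  let N : CI → ℝ → ℝ := fun u s =>
    f (Set.projIcc (0:ℝ) 1 zero_le_one s) (u (Set.projIcc (0:ℝ) 1 zero_le_one s))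
  have hNc : Continuous fun p : CI × ℝ => N p.1 p.2 := by
    have h1 : Continuous fun p : CI × ℝ =>
        (((Set.projIcc (0:ℝ) 1 zero_le_one p.2 : Set.Icc (0:ℝ) 1) : ℝ),
          p.1 (Set.projIcc (0:ℝ) 1 zero_le_one p.2)) := by
      have h2 : Continuous fun p : CI × ℝ => Set.projIcc (0:ℝ) 1 zero_le_one p.2 :=
        continuous_projIcc.comp continuous_snd
      refine (continuous_subtype_val.comp h2).prodMk ?_
      exact continuous_eval.comp (continuous_fst.prodMk h2)
    exact hf.comp_continuous h1 fun p => ⟨Subtype.coe_prop _, mem_univ _⟩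
  have hNu : ∀ u, Continuous (N u) := fun u => hNc.comp (continuous_const.prodMk continuous_id)
  have hN0 : ∀ u s, 0 ≤ N u s := fun u s => hf0 _ (Subtype.coe_prop _) _
  have hKc : ∀ t, Continuous fun s => bwK α η β t s := fun t =>
    (bwK_cont α η β hα1).comp (continuous_const.prodMk continuous_id)
  have hT' : ∀ (u : CI) (t : Set.Icc (0:ℝ) 1), T u t = H₁ u * gam α η β (t : ℝ) + H₂ u +
      ∫ s in (0:ℝ)..1, bwK α η β (t : ℝ) s * N u s := by
    intro u t
    rw [hT]
    congr 1
    refine intervalIntegral.integral_congr fun s hs => ?_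
    rw [uIcc_of_le zero_le_one] at hs
    simp only [N]
    rw [bwK_eq α η β t s hα1 hs.1, Set.IccExtend_apply, Set.projIcc_of_mem zero_le_one hs]
    congr 2
    simp [hs.1, hs.2]
  have hii : ∀ (u : CI) (t : ℝ), IntervalIntegrable (fun s => bwK α η β t s * N u s) volume 0 1 :=
    fun u t => ((hKc t).mul (hNu u)).intervalIntegrable _ _
  have hTle : ∀ u t, T u t ≤ T u z0 := by
    intro u t
    rw [hT', hT']
    have h1 : (∫ s in (0:ℝ)..1, bwK α η β (t : ℝ) s * N u s) ≤ ∫ s in (0:ℝ)..1, bwK α η β 0 s * N u s := by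
      refine intervalIntegral.integral_mono_on zero_le_one (hii u _) (hii u _) fun s hs => ?_
      exact mul_le_mul_of_nonneg_right (bwK_le α η β t s hα1 hs.1) (hN0 u s)
    have h2 := mul_le_mul_of_nonneg_left (hgle t t.2.1) (hH₁0 u)
    exact add_le_add (add_le_add h2 le_rfl) h1
  have hTge : ∀ u t, σ₁ * T u z0 ≤ T u t := by
    intro u t
    rw [hT', hT']
    have h1 : σ₁ * (∫ s in (0:ℝ)..1, bwK α η β 0 s * N u s) ≤ ∫ s in (0:ℝ)..1, bwK α η β t s * N u s := by
      rw [← intervalIntegral.integral_const_mul]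
      refine intervalIntegral.integral_mono_on zero_le_one ((hii u _).const_mul _) (hii u _) fun s hs => ?_
      rw [← mul_assoc]
      exact mul_le_mul_of_nonneg_right (hKge t s t.2.2 hs.1 hs.2) (hN0 u s)
    have h2 := mul_le_mul_of_nonneg_left (hgge t t.2.2) (hH₁0 u)
    have h3 : σ₁ * H₂ u ≤ H₂ u := mul_le_of_le_one_left (hH₂0 u) hσ_le1
    change σ₁ * (H₁ u * gam α η β 0 + H₂ u + ∫ s in (0:ℝ)..1, bwK α η β 0 s * N u s) ≤ _
    linarith
  have hTc : Continuous T := by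
    apply ContinuousMap.continuous_of_continuous_uncurry
    have h0 : Function.uncurry (fun u t => T u t) = fun p : CI × Set.Icc (0:ℝ) 1 =>
        H₁ p.1 * gam α η β (p.2 : ℝ) + H₂ p.1 + ∫ s in (0:ℝ)..1, bwK α η β (p.2 : ℝ) s * N p.1 s := by
      ext p; exact hT' p.1 p.2
    rw [h0]
    have h1 : Continuous fun p : CI × Set.Icc (0:ℝ) 1 => ∫ s in (0:ℝ)..1, bwK α η β (p.2 : ℝ) s * N p.1 s := by
      apply intervalIntegral.continuous_parametric_intervalIntegral_of_continuous'
      refine Continuous.mul ?_ ?_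
      · exact (bwK_cont α η β hα1).comp
          ((continuous_subtype_val.comp (continuous_snd.comp continuous_fst)).prodMk continuous_snd)
      · exact hNc.comp ((continuous_fst.comp continuous_fst).prodMk continuous_snd)
    have h2 : Continuous fun p : CI × Set.Icc (0:ℝ) 1 => gam α η β (p.2 : ℝ) := by
      simp only [gam]; fun_prop
    exact (((hH₁c.comp continuous_fst).mul h2).add (hH₂c.comp continuous_fst)).add h1
  -- the retraction
  let P : CI → CI := fun u => ⟨fun t => max (σ₁ * ρ) (min ρ (u t + (ρ - u z0))), by fun_prop⟩
  have hPc : Continuous P := by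
    apply ContinuousMap.continuous_of_continuous_uncurry
    have h1 : Continuous fun p : CI × Set.Icc (0:ℝ) 1 => p.1 p.2 := continuous_eval
    have h2 : Continuous fun p : CI × Set.Icc (0:ℝ) 1 => p.1 z0 :=
      continuous_eval.comp (continuous_fst.prodMk continuous_const)
    exact continuous_const.max (continuous_const.min (h1.add (continuous_const.sub h2)))
  have hPge : ∀ u t, σ₁ * ρ ≤ P u t := fun u t => le_max_left _ _
  have hPle : ∀ u t, P u t ≤ ρ := fun u t => max_le hσρ (min_le_left _ _)
  have hPz : ∀ u, P u z0 = ρ := by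
    intro u
    change max (σ₁ * ρ) (min ρ (u z0 + (ρ - u z0))) = ρ
    simp [hσρ]
  have norm_of : ∀ u : CI, (∀ t, σ₁ * ρ ≤ u t ∧ u t ≤ ρ) → u z0 = ρ → ‖u‖ = ρ := by
    intro u h h0
    apply le_antisymm
    · rw [ContinuousMap.norm_le _ hρ.le]
      intro t
      rw [Real.norm_eq_abs, abs_le]
      exact ⟨by linarith [(h t).1], (h t).2⟩
    · have := u.norm_coe_le_norm z0
      rwa [h0, Real.norm_of_nonneg hρ.le] at this
  have hPn : ∀ u, ‖P u‖ = ρ := fun u => norm_of _ (fun t => ⟨hPge u t, hPle u t⟩) (hPz u)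
  have hPid : ∀ u : CI, (∀ t, σ₁ * ρ ≤ u t ∧ u t ≤ ρ) → u z0 = ρ → P u = u := by
    intro u h h0
    ext t
    change max (σ₁ * ρ) (min ρ (u t + (ρ - u z0))) = u t
    rw [h0, sub_self, add_zero, min_eq_right (h t).2, max_eq_right (h t).1]
  -- lower bound
  set m := gam α η β 0 * η₁ + η₂ + ∫ s in (0:ℝ)..1, Kker α η β 0 s * δ s with hm
  have hTm : ∀ u, m ≤ T (P u) z0 := by
    intro u
    obtain ⟨h1, h2⟩ := hH (P u) (fun t => by rw [hPn]; exact hPge u t) (hPn u)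
    rw [hT']
    have h3 : (∫ s in (0:ℝ)..1, Kker α η β 0 s * δ s) = ∫ s in (0:ℝ)..1, bwK α η β 0 s * δ s := by
      refine intervalIntegral.integral_congr fun s hs => ?_
      rw [uIcc_of_le zero_le_one] at hs
      rw [bwK_eq α η β 0 s hα1 hs.1]
    have h4 : (∫ s in (0:ℝ)..1, bwK α η β 0 s * δ s) ≤ ∫ s in (0:ℝ)..1, bwK α η β 0 s * N (P u) s := by
      refine intervalIntegral.integral_mono_on zero_le_one ?_ (hii _ _) fun s hs => ?_
      · refine ContinuousOn.intervalIntegrable ?_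
        rw [uIcc_of_le zero_le_one]
        exact (hKc 0).continuousOn.mul hδc
      · refine mul_le_mul_of_nonneg_left ?_ (bwK_zero_nonneg α η β s hα1 hβ0 hs.1)
        simp only [N]
        have e : ((Set.projIcc (0:ℝ) 1 zero_le_one s : Set.Icc (0:ℝ) 1) : ℝ) = s := by
          rw [Set.projIcc_of_mem zero_le_one hs]
        rw [e]
        exact hfδ s hs _ ⟨hPge u _, hPle u _⟩
    have h5 : gam α η β 0 * η₁ ≤ H₁ (P u) * gam α η β 0 := by
      rw [mul_comm]; exact mul_le_mul_of_nonneg_right h1 hg0pos.le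
    change m ≤ H₁ (P u) * gam α η β 0 + H₂ (P u) + ∫ s in (0:ℝ)..1, bwK α η β 0 s * N (P u) s
    rw [hm, h3]; linarith
  have hTpos : ∀ u, 0 < T (P u) z0 := fun u => hpos.trans_le (hTm u)
  -- upper bounds
  have hPb : Bornology.IsBounded (range P) := by
    refine (Metric.isBounded_closedBall (x := (0:CI)) (r := ρ)).subset ?_
    rintro _ ⟨u, rfl⟩
    simp [hPn]
  obtain ⟨M₁, hM₁⟩ : ∃ M₁, ∀ u, H₁ (P u) ≤ M₁ := by
    obtain ⟨C, hC⟩ := (hH₁b _ hPb).exists_norm_le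
    exact ⟨C, fun u => (le_abs_self _).trans (hC _ ⟨P u, ⟨u, rfl⟩, rfl⟩)⟩
  obtain ⟨Mf, hMf⟩ : ∃ Mf, ∀ u s, N (P u) s ≤ Mf := by
    obtain ⟨C, hC⟩ := (isCompact_Icc.prod isCompact_Icc).exists_bound_of_continuousOn
      (s := Set.Icc (0:ℝ) 1 ×ˢ Set.Icc (σ₁ * ρ) ρ)
      (hf.mono (Set.prod_mono subset_rfl (subset_univ _)))
    refine ⟨C, fun u s => (le_abs_self _).trans ?_⟩
    exact hC (((Set.projIcc (0:ℝ) 1 zero_le_one s : Set.Icc (0:ℝ) 1) : ℝ),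
      P u (Set.projIcc (0:ℝ) 1 zero_le_one s)) ⟨Subtype.coe_prop _, hPge u _, hPle u _⟩
  have hMf0 : 0 ≤ Mf := (hN0 (P 0) 0).trans (hMf 0 0)
  have hM₁0 : 0 ≤ M₁ := (hH₁0 (P 0)).trans (hM₁ 0)
  let b0 : ℝ → ℝ := fun d => M₁ * |d| + |d| ^ (α - 1) / Real.Gamma α * Mf
  have hb00 : ∀ d, 0 ≤ b0 d := fun d => by simp only [b0]; positivity
  have hmod : ∀ u (t t' : Set.Icc (0:ℝ) 1), |T (P u) t - T (P u) t'| ≤ b0 (dist t t') := by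
    intro u t t'
    rw [hT', hT']
    have e : H₁ (P u) * gam α η β t + H₂ (P u) + (∫ s in (0:ℝ)..1, bwK α η β t s * N (P u) s)
        - (H₁ (P u) * gam α η β t' + H₂ (P u) + ∫ s in (0:ℝ)..1, bwK α η β t' s * N (P u) s)
        = H₁ (P u) * ((t':ℝ) - t) + ∫ s in (0:ℝ)..1, (bwK α η β t s - bwK α η β t' s) * N (P u) s := by
      simp_rw [sub_mul]
      rw [intervalIntegral.integral_sub (hii _ _) (hii _ _)]
      simp only [gam]; ring
    rw [e]
    have hdist : |dist t t'| = |(t:ℝ) - t'| := by rw [abs_of_nonneg dist_nonneg]; rfl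
    simp only [b0]
    rw [hdist]
    refine (abs_add_le _ _).trans (add_le_add ?_ ?_)
    · rw [abs_mul, abs_of_nonneg (hH₁0 _), abs_sub_comm]
      gcongr
      exact hM₁ u
    · have := intervalIntegral.norm_integral_le_of_norm_le_const (a := (0:ℝ)) (b := 1)
        (f := fun s => (bwK α η β t s - bwK α η β t' s) * N (P u) s)
        (C := |(t:ℝ) - t'| ^ (α - 1) / Real.Gamma α * Mf) (fun s _ => by
          rw [norm_mul, Real.norm_eq_abs, Real.norm_eq_abs, abs_of_nonneg (hN0 _ _)]
          exact mul_le_mul (bwK_holder α η β t t' s hα1 hα2) (hMf u s) (hN0 _ _) (by positivity))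
      simpa using this
  let G : CI → CI := fun u => (ρ / T (P u) z0) • T (P u)
  have hGc : Continuous G := by
    have h1 : Continuous fun u => T (P u) := hTc.comp hPc
    have h2 : Continuous fun u => T (P u) z0 := continuous_eval.comp (h1.prodMk continuous_const)
    exact (continuous_const.div h2 fun u => (hTpos u).ne').smul h1
  have hGz : ∀ u, G u z0 = ρ := fun u => by
    change ρ / T (P u) z0 * T (P u) z0 = ρ
    exact div_mul_cancel₀ _ (hTpos u).ne'
  have hGb : ∀ u t, σ₁ * ρ ≤ G u t ∧ G u t ≤ ρ := by
    intro u t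
    have hc : 0 < ρ / T (P u) z0 := div_pos hρ (hTpos u)
    have hz : ρ / T (P u) z0 * T (P u) z0 = ρ := hGz u
    change σ₁ * ρ ≤ ρ / T (P u) z0 * T (P u) t ∧ ρ / T (P u) z0 * T (P u) t ≤ ρ
    have h1 := mul_le_mul_of_nonneg_left (hTle (P u) t) hc.le
    have h2 := mul_le_mul_of_nonneg_left (hTge (P u) t) hc.le
    constructor
    · have : σ₁ * ρ = ρ / T (P u) z0 * (σ₁ * T (P u) z0) := by
        rw [mul_left_comm, hz]
      rw [this]; exact h2
    · rw [hz] at h1; exact h1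
  have hb : Filter.Tendsto (fun d => ρ / m * b0 d) (nhds 0) (nhds 0) := by
    have hc : Continuous fun d => ρ / m * b0 d := by
      have hr : Continuous fun x : ℝ => |x| ^ (α - 1) :=
        (Real.continuous_rpow_const (by linarith)).comp continuous_abs
      simp only [b0]; fun_prop
    have h0 : ρ / m * b0 0 = 0 := by
      simp only [b0]; rw [abs_zero, Real.zero_rpow (by linarith)]; simp
    have := hc.tendsto 0
    rwa [h0] at this
  obtain ⟨u, hu⟩ := bw_schauder G hGc _ (bw_compact ρ (fun d => ρ / m * b0 d) hb) (by
    intro u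
    refine ⟨fun t => abs_le.2 ⟨by linarith [(hGb u t).1], (hGb u t).2⟩, fun t t' => ?_⟩
    rw [Real.dist_eq]
    change |ρ / T (P u) z0 * T (P u) t - ρ / T (P u) z0 * T (P u) t'| ≤ _
    rw [← mul_sub, abs_mul, abs_of_pos (div_pos hρ (hTpos u))]
    refine mul_le_mul ?_ (hmod u t t') (abs_nonneg _) (by positivity)
    exact div_le_div_of_nonneg_left hρ.le hpos (hTm u))
  have hub : ∀ t, σ₁ * ρ ≤ u t ∧ u t ≤ ρ := by rw [← hu]; exact hGb u
  have huz : u z0 = ρ := by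
    have := hGz u
    rwa [hu] at this
  have hPu := hPid u hub huz
  refine ⟨ρ / T (P u) z0, div_pos hρ (hTpos u), u, norm_of u hub huz, ?_, hub⟩
  have h1 : (ρ / T (P u) z0) • T (P u) = u := hu
  rw [hPu] at h1 ⊢
  exact h1.symm
end

section
/- (Existence, Case 2) Suppose β = max{β_K, β_γ}, fix b ∈ [η,1) and let ρ > 0. Set σ₂ = min{σ_{2,γ}, c_{2,K}, 1}, where c_{2,K} = (βΓ(α) − (b−η)^{α−1})/(βΓ(α) + η^{α−1}) and σ_{2,γ} = (β + (η−b)Γ(3−α))/(β + ηΓ(3−α)). Assume: (i) there exists a continuous δ : [0,b] → [0,∞) with f(t,u) ≥ δ(t) for all (t,u) ∈ [0,b]×[σ₂ρ, ρ]; (ii) there exist η₁, η₂ ≥ 0 with H₁[u] ≥ η₁ and H₂[u] ≥ η₂ for every u ∈ C([0,1],ℝ) satisfying u ≥ 0 on [0,1], min_{t∈[0,b]} u(t) ≥ σ₂‖u‖_∞ and ‖u‖_∞ = ρ; (iii) γ(0)·η₁ + η₂ + ∫₀ᵇ K(0,s)δ(s) ds > 0. Then there exist λ_ρ > 0 and u_ρ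 ∈ C([0,1],ℝ) with ‖u_ρ‖_∞ = ρ such that u_ρ = λ_ρ·T(u_ρ), u_ρ(t) ≥ 0 for every t ∈ [0,1], and σ₂ρ ≤ u_ρ(t) ≤ ρ for every t ∈ [0,b]. -/
open Set MeasureTheory

section Brouwer
variable {E : Type*} [NormedAddCommGroup E] [InnerProductSpace ℝ E] [FiniteDimensional ℝ E]

theorem det_interp (A : E →L[ℝ] E) (s : Finset ℝ) (hs : s.card = Module.finrank ℝ E + 1) :
    (1 + A).det = ∑ τ ∈ s, (Lagrange.basis s id τ).eval 1 * (1 + τ • A).det := by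
  classical
  let bs := Module.finBasis ℝ E
  let M := LinearMap.toMatrix bs bs (A : E →ₗ[ℝ] E)
  let p : Polynomial ℝ := Matrix.det ((Polynomial.X : Polynomial ℝ) • M.map Polynomial.C + (1 : Matrix _ _ ℝ).map Polynomial.C)
  have hp : ∀ τ : ℝ, p.eval τ = (1 + τ • A).det := by
    intro τ
    have h1 : (1 + τ • A).det = Matrix.det (1 + τ • M) := by
      rw [ContinuousLinearMap.det, ← LinearMap.det_toMatrix bs]
      congr 1
      simp [M, LinearMap.toMatrix_one]
    rw [h1]
    simp only [p]
    rw [← Polynomial.coe_evalRingHom, RingHom.map_det]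
    congr 1
    ext i j
    by_cases h : i = j <;> (simp [h, add_comm]; ring)
  have hdeg : p.degree < s.card := by
    refine lt_of_le_of_lt Polynomial.degree_le_natDegree ?_
    have := Polynomial.natDegree_det_X_add_C_le M 1
    rw [Fintype.card_fin] at this
    rw [hs]
    exact_mod_cast Nat.lt_succ_of_le this
  have h := Lagrange.eq_interpolate (v := id) (Function.injective_id.injOn) hdeg
  have h2 := congrArg (Polynomial.eval 1) h
  rw [hp, Lagrange.interpolate_apply, Polynomial.eval_finsetSum] at h2
  simp only [Polynomial.eval_mul, Polynomial.eval_C, id, hp, one_smul] at h2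
  rw [h2]
  exact Finset.sum_congr rfl fun _ _ => mul_comm _ _

theorem no_retraction (r : E → E)
    (hr : ∀ x ∈ Metric.closedBall (0:E) 1, ContDiffAt ℝ 1 r x)
    (hr1 : ∀ x ∈ Metric.closedBall (0:E) 1, ‖r x‖ = 1)
    (hrs : ∀ x, ‖x‖ = 1 → r x = x) : False := by
  borelize E
  let μ : Measure E := Measure.addHaar
  let U := Metric.ball (0:E) 1
  let B := Metric.closedBall (0:E) 1
  have hUB : U ⊆ B := Metric.ball_subset_closedBall
  let A : E → E →L[ℝ] E := fun x => fderiv ℝ r x - 1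
  have hAc : ContinuousOn A B := fun x hx =>
    (((hr x hx).continuousAt_fderiv (by norm_num)).sub continuousAt_const).continuousWithinAt
  have hBc : IsCompact B := isCompact_closedBall _ _
  obtain ⟨C, hC⟩ := hBc.exists_bound_of_continuousOn hAc
  have hC0 : 0 ≤ C := le_trans (norm_nonneg _) (hC 0 (by simp [B]))
  -- det positivity
  have hdet : ∀ᶠ L : E →L[ℝ] E in nhds 1, 0 < L.det := by
    have : ContinuousAt (fun L : E →L[ℝ] E => L.det) 1 :=
      ContinuousLinearMap.continuous_det.continuousAt
    refine this.eventually (lt_mem_nhds ?_)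
    simp [ContinuousLinearMap.det]
  obtain ⟨ε, hε, hdet⟩ := Metric.eventually_nhds_iff.1 hdet
  let t0 : ℝ := min (1/2) (min ε 1 / (2 * (C + 1)))
  have ht0 : 0 < t0 := by positivity
  have key : ∀ t, 0 < t → t < t0 → (∀ x ∈ B, 0 < (1 + t • A x).det) ∧
      (∫ x in U, (1 + t • A x).det ∂μ) = μ.real U := by
    intro t ht htt
    have ht1 : t < 1 := lt_of_lt_of_le htt ((min_le_left _ _).trans (by norm_num))
    have htC : t * (C + 1) < min ε 1 / 2 := by
      have := lt_of_lt_of_le htt (min_le_right _ _)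
      rw [lt_div_iff₀ (by positivity)] at this
      linarith
    have htCε : t * C < ε := by
      have := min_le_left ε 1
      nlinarith
    have htC1 : t * C < 1 := by
      have := min_le_right ε 1
      nlinarith
    have hpos : ∀ x ∈ B, 0 < (1 + t • A x).det := by
      intro x hx
      apply hdet
      rw [dist_eq_norm, add_sub_cancel_left, norm_smul, Real.norm_of_nonneg ht.le]
      exact lt_of_le_of_lt (mul_le_mul_of_nonneg_left (hC x hx) ht.le) htCε
    refine ⟨hpos, ?_⟩
    let h : E → E := fun x => x + t • (r x - x)
    have hder : ∀ x ∈ B, HasFDerivAt h (1 + t • A x) x := by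
      intro x hx
      have h1 := ((hr x hx).differentiableAt (by norm_num)).hasFDerivAt
      exact (hasFDerivAt_id x).add ((h1.sub (hasFDerivAt_id x)).const_smul t)
    have happ : ApproximatesLinearOn h ((ContinuousLinearEquiv.refl ℝ E : E ≃L[ℝ] E) : E →L[ℝ] E) B (Real.toNNReal (t * C)) := by
      intro x hx y hy
      rw [Real.coe_toNNReal _ (by positivity)]
      have := (convex_closedBall (0:E) 1).norm_image_sub_le_of_norm_hasFDerivWithin_le
        (f := fun x => t • (r x - x)) (f' := fun x => t • A x) (C := t * C)
        (fun z hz => ((((hr z hz).differentiableAt (by norm_num)).hasFDerivAt.sub (hasFDerivAt_id z)).const_smul t).hasFDerivWithinAt)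
        (fun z hz => by
          rw [norm_smul, Real.norm_of_nonneg ht.le]
          exact mul_le_mul_of_nonneg_left (hC z hz) ht.le) hy hx
      convert this using 2
      simp [h]; abel
    have hc : Subsingleton E ∨ Real.toNNReal (t * C) < ‖((ContinuousLinearEquiv.refl ℝ E).symm : E →L[ℝ] E)‖₊⁻¹ := by
      rcases subsingleton_or_nontrivial E with hE | hE
      · exact Or.inl hE
      · right
        have : ‖((ContinuousLinearEquiv.refl ℝ E).symm : E →L[ℝ] E)‖₊ = 1 := by
          simp
        rw [this]
        simpa using htC1
    have hinj : InjOn h U := (happ.injOn hc).mono hUB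
    have hopen : IsOpen (h '' U) :=
      (happ.mono_set hUB).open_image (ContinuousLinearEquiv.refl ℝ E).toNonlinearRightInverse
        Metric.isOpen_ball hc
    have hhc : ContinuousOn h B := fun x hx => (hder x hx).continuousAt.continuousWithinAt
    have hclosed : IsClosed (h '' B) := (hBc.image_of_continuousOn hhc).isClosed
    have hmaps : h '' U ⊆ U := by
      rintro _ ⟨x, hx, rfl⟩
      have hx' : ‖x‖ < 1 := by simpa [U] using hx
      have e : h x = (1 - t) • x + t • r x := by simp only [h]; module
      have : ‖h x‖ ≤ (1 - t) * ‖x‖ + t * 1 := by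
        rw [e]
        refine (norm_add_le _ _).trans ?_
        rw [norm_smul, norm_smul, hr1 x (hUB hx), Real.norm_of_nonneg ht.le, Real.norm_of_nonneg (by linarith)]
      simp only [U, mem_ball_zero_iff]
      nlinarith
    have himg : h '' U = U := by
      refine Subset.antisymm hmaps ?_
      have hpre : IsPreconnected U := (convex_ball (0:E) 1).isPreconnected
      refine hpre.subset_left_of_subset_union (v := (h '' B)ᶜ) hopen hclosed.isOpen_compl ?_ ?_ ?_
      · exact disjoint_compl_right.mono_left (image_mono hUB)
      · intro y hy
        by_cases hyB : y ∈ h '' B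
        · left
          obtain ⟨x, hx, rfl⟩ := hyB
          rcases (mem_closedBall_zero_iff.1 hx).lt_or_eq with h1 | h1
          · exact ⟨x, by simpa [U] using h1, rfl⟩
          · exfalso
            have : h x = x := by simp [h, hrs x h1]
            rw [this] at hy
            have : ‖x‖ < 1 := by simpa [U] using hy
            linarith
        · exact Or.inr hyB
      · have h0 : (0:E) ∈ U := by simp [U]
        exact ⟨h 0, hmaps ⟨0, h0, rfl⟩, 0, h0, rfl⟩
    have hl := lintegral_abs_det_fderiv_eq_addHaar_image μ (s := U) (f := h) (f' := fun x => 1 + t • A x)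
      measurableSet_ball (fun x hx => (hder x (hUB hx)).hasFDerivWithinAt) hinj
    rw [himg] at hl
    rw [integral_eq_lintegral_of_nonneg_ae, Measure.real, ← hl]
    · congr 1
      refine setLIntegral_congr_fun measurableSet_ball fun x hx => ?_
      rw [abs_of_pos (hpos x (hUB hx))]
    · exact (ae_restrict_iff' measurableSet_ball).2 (Filter.Eventually.of_forall fun x hx => (hpos x (hUB hx)).le)
    · refine ContinuousOn.aestronglyMeasurable ?_ measurableSet_ball
      refine ContinuousLinearMap.continuous_det.comp_continuousOn ?_
      exact continuousOn_const.add ((hAc.mono hUB).const_smul t)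
  -- interpolation
  obtain ⟨s, hs, hcard⟩ := (Set.Ioo_infinite ht0).exists_subset_card_eq (Module.finrank ℝ E + 1)
  have hzero : ∀ x ∈ U, (1 + A x).det = 0 := by
    intro x hx
    have e : 1 + A x = fderiv ℝ r x := by simp [A]
    rw [e]
    by_contra hne
    have hsurj : Function.Surjective (fderiv ℝ r x) := by
      have := LinearMap.equivOfDetNeZero (fderiv ℝ r x : E →ₗ[ℝ] E) hne
      exact (LinearMap.equivOfDetNeZero (fderiv ℝ r x : E →ₗ[ℝ] E) hne).surjective
    obtain ⟨v, hv⟩ := hsurj (r x)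
    have hd := ((hr x (hUB hx)).differentiableAt (by norm_num)).hasFDerivAt
    have h1 := hd.inner ℝ hd
    have h2 : HasFDerivAt (fun y => inner ℝ (r y) (r y)) (0 : E →L[ℝ] ℝ) x := by
      refine (hasFDerivAt_const (1:ℝ) x).congr_of_eventuallyEq ?_
      filter_upwards [Metric.isOpen_ball.mem_nhds hx] with y hy
      rw [real_inner_self_eq_norm_sq, hr1 y (hUB hy)]; norm_num
    have h3 := congrArg (fun L : E →L[ℝ] ℝ => L v) (h1.unique h2)
    simp [hv, hr1 x (hUB hx)] at h3
  have hint : ∀ τ : ℝ, IntegrableOn (fun x => (1 + τ • A x).det) U μ := by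
    intro τ
    refine IntegrableOn.mono_set (t := B) ?_ hUB
    refine ContinuousOn.integrableOn_compact hBc ?_
    refine ContinuousLinearMap.continuous_det.comp_continuousOn ?_
    exact continuousOn_const.add (hAc.const_smul τ)
  have h0 : (∫ x in U, (1 + A x).det ∂μ) = 0 := by
    rw [setIntegral_congr_fun (g := fun _ => (0:ℝ)) measurableSet_ball hzero]; simp
  simp_rw [fun x => det_interp (A x) s hcard] at h0
  rw [integral_finsetSum _ (fun τ _ => (hint τ).const_mul _)] at h0
  simp_rw [integral_const_mul] at h0
  rw [Finset.sum_congr rfl (fun τ hτ => by rw [(key τ (hs hτ).1 (hs hτ).2).2])] at h0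
  rw [← Finset.sum_mul, ← Polynomial.eval_finsetSum, Lagrange.sum_basis (Function.injective_id.injOn) (Finset.card_pos.1 (by omega))] at h0
  simp only [Polynomial.eval_one, one_mul] at h0
  have : 0 < μ.real U := by
    rw [Measure.real, ENNReal.toReal_pos_iff]
    exact ⟨Metric.measure_ball_pos μ _ one_pos, measure_ball_lt_top⟩
  linarith

theorem brouwer_ball (f : E → E) (hf : Continuous f) (hf1 : ∀ x, ‖f x‖ ≤ 1) : ∃ x, f x = x := by
  by_contra hcon
  push Not at hcon
  let B := Metric.closedBall (0:E) 1
  have hBc : IsCompact B := isCompact_closedBall _ _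
  obtain ⟨x0, hx0, hmin⟩ := hBc.exists_isMinOn ⟨0, by simp [B]⟩
    (f := fun x => ‖f x - x‖) (by fun_prop)
  let m := ‖f x0 - x0‖
  have hm : 0 < m := norm_pos_iff.2 (sub_ne_zero.2 (hcon x0))
  let δ : ℝ := m / 4
  have hδ : 0 < δ := by positivity
  obtain ⟨g0, hg0, hg0f, -⟩ := hf.exists_contDiff_approx 1 (ε := fun _ => δ) continuous_const (fun _ => hδ)
  let g : E → E := fun x => (1 + δ)⁻¹ • g0 x
  have hg0n : ∀ x, ‖g0 x‖ < 1 + δ := by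
    intro x
    have h1 := hg0f x
    rw [dist_eq_norm] at h1
    have h2 := hf1 x
    have h3 : ‖g0 x‖ ≤ ‖g0 x - f x‖ + ‖f x‖ := by
      simpa using norm_add_le (g0 x - f x) (f x)
    linarith
  have hgn : ∀ x, ‖g x‖ < 1 := by
    intro x
    simp only [g]
    rw [norm_smul, norm_inv, Real.norm_of_nonneg (by positivity : (0:ℝ) ≤ 1 + δ), inv_mul_lt_iff₀ (by positivity)]
    simpa using hg0n x
  have hgne : ∀ x ∈ B, x - g x ≠ 0 := by
    intro x hx h0
    have h1 : m ≤ ‖f x - x‖ := hmin hx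
    have h2 := hg0f x
    rw [dist_eq_norm] at h2
    have h3 : g0 x - g x = δ • g x := by
      have : g0 x = (1 + δ) • g x := by
        simp only [g]; rw [smul_smul, mul_inv_cancel₀ (by positivity), one_smul]
      rw [this]; module
    have h4 : ‖g0 x - g x‖ ≤ δ := by
      rw [h3, norm_smul, Real.norm_of_nonneg hδ.le]
      nlinarith [hgn x]
    have h5 : f x - x = -(g0 x - f x) + (g0 x - g x) := by
      rw [sub_eq_zero] at h0
      nth_rewrite 2 [h0]; abel
    have h6 : ‖f x - x‖ ≤ ‖g0 x - f x‖ + ‖g0 x - g x‖ := by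
      rw [h5]; refine (norm_add_le _ _).trans ?_; rw [norm_neg]
    have : m = 4 * δ := by simp only [δ]; ring
    linarith
  have hg : ContDiff ℝ 1 g := contDiff_const.smul hg0
  let v : E → E := fun x => x - g x
  have hv : ContDiff ℝ 1 v := contDiff_id.sub hg
  let a : E → ℝ := fun x => inner ℝ (v x) (v x)
  let b : E → ℝ := fun x => inner ℝ x (v x)
  let c : E → ℝ := fun x => 1 - inner ℝ x x
  let D : E → ℝ := fun x => b x ^ 2 + a x * c x
  have ha : ContDiff ℝ 1 a := hv.inner ℝ hv
  have hb : ContDiff ℝ 1 b := contDiff_id.inner ℝ hv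
  have hc : ContDiff ℝ 1 c := contDiff_const.sub (contDiff_id.inner ℝ contDiff_id)
  have hD : ContDiff ℝ 1 D := (hb.pow 2).add (ha.mul hc)
  have hapos : ∀ x ∈ B, 0 < a x := fun x hx => real_inner_self_pos.2 (hgne x hx)
  have hbpos : ∀ x, ‖x‖ = 1 → 0 < b x := by
    intro x hx
    simp only [b, v, inner_sub_right, real_inner_self_eq_norm_sq, hx]
    have := real_inner_le_norm x (g x)
    rw [hx] at this
    have := hgn x
    linarith
  have hDpos : ∀ x ∈ B, 0 < D x := by
    intro x hx
    have h1 := hapos x hx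
    rcases (mem_closedBall_zero_iff.1 hx).lt_or_eq with h | h
    · have : 0 < c x := by
        simp only [c, real_inner_self_eq_norm_sq]
        nlinarith [norm_nonneg x]
      simp only [D]; positivity
    · have := hbpos x h
      have hc0 : c x = 0 := by simp [c, h]
      simp only [D, hc0]; positivity
  let τ : E → ℝ := fun x => (-b x + Real.sqrt (D x)) / a x
  refine no_retraction (fun x => x + τ x • v x) ?_ ?_ ?_
  · intro x hx
    have hsq : ContDiffAt ℝ 1 (fun x => Real.sqrt (D x)) x :=
      hD.contDiffAt.sqrt (hDpos x hx).ne'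
    exact contDiffAt_id.add (((hb.contDiffAt.neg.add hsq).div ha.contDiffAt (hapos x hx).ne').smul hv.contDiffAt)
  · intro x hx
    have h1 := hapos x hx
    have hs := Real.sq_sqrt (hDpos x hx).le
    have ht : a x * τ x = -b x + Real.sqrt (D x) := by
      simp only [τ]; field_simp
    have e : ‖x + τ x • v x‖ ^ 2 = 1 - c x + 2 * τ x * b x + τ x ^ 2 * a x := by
      rw [← real_inner_self_eq_norm_sq, real_inner_add_add_self, inner_smul_right, inner_smul_left, inner_smul_right]
      simp only [a, b, c, conj_trivial]; ring
    have e2 : a x * (‖x + τ x • v x‖ ^ 2 - 1) = 0 := by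
      rw [e]
      have : Real.sqrt (D x) = a x * τ x + b x := by linarith
      rw [this] at hs
      simp only [D] at hs
      linear_combination hs
    have e3 : ‖x + τ x • v x‖ ^ 2 = 1 := by
      rcases mul_eq_zero.1 e2 with h | h <;> linarith
    exact (pow_eq_one_iff_of_nonneg (norm_nonneg _) two_ne_zero).1 e3
  · intro x hx
    have hb0 := hbpos x hx
    have hc0 : c x = 0 := by simp [c, hx]
    have : τ x = 0 := by
      simp only [τ, D, hc0, mul_zero, add_zero, Real.sqrt_sq hb0.le]; simp
    simp [this]

end Brouwer

theorem schauder {X : Type*} [NormedAddCommGroup X] [NormedSpace ℝ X] (S : Set X)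
    (hS : IsCompact S) (hconv : Convex ℝ S) (hne : S.Nonempty) (F : X → X)
    (hF : ContinuousOn F S) (hmaps : MapsTo F S S) : ∃ x ∈ S, F x = x := by
  suffices H : ∀ ε > 0, ∃ x ∈ S, ‖F x - x‖ ≤ ε by
    obtain ⟨x0, hx0, hmin⟩ := hS.exists_isMinOn hne (f := fun x => ‖F x - x‖)
      (hF.sub continuousOn_id).norm
    refine ⟨x0, hx0, ?_⟩
    by_contra hcon
    have hm : 0 < ‖F x0 - x0‖ := norm_pos_iff.2 (sub_ne_zero.2 hcon)
    obtain ⟨x, hx, hxe⟩ := H (‖F x0 - x0‖ / 2) (by positivity)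
    have : ‖F x0 - x0‖ ≤ ‖F x - x‖ := hmin hx
    linarith
  intro ε hε
  obtain ⟨t, htS, htf, hcov⟩ := hS.finite_cover_balls hε
  have : Fintype t := htf.fintype
  have htne : t.Nonempty := by
    obtain ⟨x, hx⟩ := hne
    obtain ⟨y, hy, -⟩ := mem_iUnion₂.1 (hcov hx)
    exact ⟨y, hy⟩
  have : Nonempty t := htne.to_subtype
  have hcard : (0:ℝ) < Fintype.card t := by exact_mod_cast Fintype.card_pos
  let sp : EuclideanSpace ℝ t → ℝ := fun x => ∑ j, max (x j) 0
  let w : EuclideanSpace ℝ t → t → ℝ := fun x i =>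
    (max (x i) 0 + max (1 - sp x) 0 / Fintype.card t) / max 1 (sp x)
  have hspc : Continuous sp := by simp only [sp]; fun_prop
  have hden : ∀ x, 0 < max 1 (sp x) := fun x => lt_of_lt_of_le one_pos (le_max_left _ _)
  have hwc : ∀ i, Continuous fun x => w x i := by
    intro i
    refine Continuous.div ?_ ?_ fun x => (hden x).ne'
    · fun_prop
    · fun_prop
  have hw0 : ∀ x i, 0 ≤ w x i := by
    intro x i
    have := hden x
    simp only [w]; positivity
  have hw1 : ∀ x, ∑ i, w x i = 1 := by
    intro x
    simp only [w]
    rw [← Finset.sum_div, Finset.sum_add_distrib, Finset.sum_const, Finset.card_univ, nsmul_eq_mul,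
      mul_div_cancel₀ _ hcard.ne', div_eq_one_iff_eq (hden x).ne']
    change sp x + _ = _
    rcases le_total (sp x) 1 with h | h
    · rw [max_eq_left (by linarith), max_eq_left h]; ring
    · rw [max_eq_right (by linarith), max_eq_right h]; ring
  have hwx : ∀ x : EuclideanSpace ℝ t, (∀ i, 0 ≤ x i) → ∑ i, x i = 1 → ∀ i, w x i = x i := by
    intro x hx hs i
    have : sp x = 1 := by
      simp only [sp]; rw [← hs]
      exact Finset.sum_congr rfl fun j _ => max_eq_left (hx j)
    simp only [w, this, max_eq_left (hx i)]; simp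
  let P : EuclideanSpace ℝ t → X := fun x => ∑ i, w x i • (i : X)
  have hPc : Continuous P := continuous_finsetSum _ fun i _ => (hwc i).smul continuous_const
  have hPS : ∀ x, P x ∈ S := fun x =>
    hconv.sum_mem (fun i _ => hw0 x i) (hw1 x) (fun i _ => htS i.2)
  have hzS : ∀ x, F (P x) ∈ S := fun x => hmaps (hPS x)
  have hzc : Continuous fun x => F (P x) := hF.comp_continuous hPc hPS
  let φ : X → t → ℝ := fun z i => max (ε - ‖z - i‖) 0
  let Φ : X → ℝ := fun z => ∑ i, φ z i
  have hφ0 : ∀ z i, 0 ≤ φ z i := fun z i => le_max_right _ _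
  have hΦ : ∀ z ∈ S, 0 < Φ z := by
    intro z hz
    obtain ⟨y, hy, hzy⟩ := mem_iUnion₂.1 (hcov hz)
    refine Finset.sum_pos' (fun i _ => hφ0 z i) ⟨⟨y, hy⟩, Finset.mem_univ _, ?_⟩
    refine lt_max_of_lt_left ?_
    rw [mem_ball_iff_norm] at hzy
    simpa using hzy
  have hφc : ∀ i, Continuous fun z => φ z i := fun i => by simp only [φ]; fun_prop
  have hΦc : Continuous Φ := continuous_finsetSum _ fun i _ => hφc i
  let q : EuclideanSpace ℝ t → t → ℝ := fun x i => φ (F (P x)) i / Φ (F (P x))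
  have hq0 : ∀ x i, 0 ≤ q x i := fun x i => div_nonneg (hφ0 _ _) (hΦ _ (hzS x)).le
  have hq1 : ∀ x, ∑ i, q x i = 1 := by
    intro x
    simp only [q]
    rw [← Finset.sum_div]
    exact div_self (hΦ _ (hzS x)).ne'
  have hqc : Continuous q := continuous_pi fun i =>
    ((hφc i).comp hzc).div (hΦc.comp hzc) fun x => (hΦ _ (hzS x)).ne'
  let f : EuclideanSpace ℝ t → EuclideanSpace ℝ t := fun x => WithLp.toLp 2 (q x)
  have hfc : Continuous f := (PiLp.continuous_toLp 2 _).comp hqc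
  obtain ⟨x, hx⟩ := brouwer_ball f hfc (by
    intro x
    rw [EuclideanSpace.norm_eq, Real.sqrt_le_iff]
    refine ⟨zero_le_one, ?_⟩
    rw [one_pow, ← hq1 x]
    refine Finset.sum_le_sum fun i _ => ?_
    have h1 : q x i ≤ 1 := by
      rw [← hq1 x]
      exact Finset.single_le_sum (fun j _ => hq0 x j) (Finset.mem_univ i)
    have h0 := hq0 x i
    simp only [f, Real.norm_eq_abs, sq_abs]
    nlinarith)
  have hxq : ∀ i, x i = q x i := fun i => by
    nth_rewrite 1 [← hx]; rfl
  have hwq : ∀ i, w x i = q x i := fun i => by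
    rw [hwx x (fun i => by rw [hxq]; exact hq0 x i) (by simp_rw [hxq]; exact hq1 x) i, hxq]
  refine ⟨P x, hPS x, ?_⟩
  have e : F (P x) - P x = ∑ i, w x i • (F (P x) - (i : X)) := by
    simp_rw [smul_sub]
    rw [Finset.sum_sub_distrib, ← Finset.sum_smul, hw1, one_smul]
  rw [e]
  refine (norm_sum_le _ _).trans ?_
  calc ∑ i, ‖w x i • (F (P x) - (i : X))‖ ≤ ∑ i, w x i * ε := by
        refine Finset.sum_le_sum fun i _ => ?_
        rw [norm_smul, Real.norm_of_nonneg (hw0 x i)]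
        rcases le_or_gt ‖F (P x) - (i : X)‖ ε with h | h
        · exact mul_le_mul_of_nonneg_left h (hw0 x i)
        · have : w x i = 0 := by
            rw [hwq]
            simp only [q, φ]
            rw [max_eq_right (by linarith), zero_div]
          simp [this]
    _ = ε := by rw [← Finset.sum_mul, hw1, one_mul]

theorem phi_sub (a : ℝ) (ha0 : 0 < a) (ha1 : a ≤ 1) (x y : ℝ) (hxy : y ≤ x) :
    max x 0 ^ a ≤ max y 0 ^ a + (x - y) ^ a := by
  have h1 : max x 0 ≤ max y 0 + (x - y) := by
    rcases le_total x 0 with h | h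
    · rw [max_eq_right h]; have := le_max_right y 0; linarith
    · rw [max_eq_left h]; have := le_max_left y 0; linarith
  calc max x 0 ^ a ≤ (max y 0 + (x - y)) ^ a :=
        Real.rpow_le_rpow (le_max_right _ _) h1 ha0.le
    _ ≤ _ := Real.rpow_add_le_add_rpow (le_max_right _ _) (by linarith) ha0.le ha1

theorem phi_mono (a : ℝ) (ha0 : 0 < a) (x y : ℝ) (hxy : x ≤ y) :
    max x 0 ^ a ≤ max y 0 ^ a :=
  Real.rpow_le_rpow (le_max_right _ _) (max_le_max_right _ hxy) ha0.le

/-- Continuous version of the kernel. -/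
noncomputable def Kc (α η β t s : ℝ) : ℝ :=
  β + max (η - s) 0 ^ (α - 1) / Real.Gamma α - max (t - s) 0 ^ (α - 1) / Real.Gamma α

theorem ind_eq (a G η s : ℝ) (ha : 0 < a) (hs : 0 ≤ s) :
    (Set.Icc (0:ℝ) η).indicator (fun x => (η - x) ^ a / G) s = max (η - s) 0 ^ a / G := by
  by_cases h : s ≤ η
  · rw [Set.indicator_of_mem (show s ∈ Set.Icc 0 η from ⟨hs, h⟩), max_eq_left (by linarith)]
  · rw [Set.indicator_of_notMem (fun h' => h h'.2), max_eq_right (by linarith),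
      Real.zero_rpow ha.ne', zero_div]

theorem Kker_eq (α η β t s : ℝ) (hα : 1 < α) (hs : 0 ≤ s) :
    Kker α η β t s = Kc α η β t s := by
  rw [Kker, Kc, ind_eq _ _ _ _ (by linarith) hs, ind_eq _ _ _ _ (by linarith) hs]

theorem Kc_cont (α η β : ℝ) (hα : 1 < α) : Continuous fun p : ℝ × ℝ => Kc α η β p.1 p.2 := by
  have h : ∀ g : ℝ × ℝ → ℝ, Continuous g → Continuous fun p => max (g p) 0 ^ (α - 1) := by
    intro g hg
    exact (hg.max continuous_const).rpow_const fun _ => Or.inr (by linarith)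
  simp only [Kc]
  exact (continuous_const.add ((h _ (by fun_prop)).div_const _)).sub ((h _ (by fun_prop)).div_const _)

theorem Kc_anti (α η β t t' s : ℝ) (hα : 1 < α) (h : t ≤ t') :
    Kc α η β t' s ≤ Kc α η β t s := by
  have hG := Real.Gamma_pos_of_pos (show (0:ℝ) < α by linarith)
  have := phi_mono (α - 1) (by linarith) (t - s) (t' - s) (by linarith)
  have := div_le_div_of_nonneg_right this hG.le
  simp only [Kc]; linarith

theorem Kc_sub (α η β t t' s : ℝ) (hα : 1 < α) (hα2 : α ≤ 2) (h : t ≤ t') :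
    Kc α η β t s ≤ Kc α η β t' s + (t' - t) ^ (α - 1) / Real.Gamma α := by
  have hG := Real.Gamma_pos_of_pos (show (0:ℝ) < α by linarith)
  have := phi_sub (α - 1) (by linarith) (by linarith) (t' - s) (t - s) (by linarith)
  have := div_le_div_of_nonneg_right this hG.le
  rw [add_div, show t' - s - (t - s) = t' - t by ring] at this
  simp only [Kc]; linarith

theorem Kc_lower (α η β t b s : ℝ) (hα : 1 < α) (hα2 : α ≤ 2) (hb : η ≤ b) (h : t ≤ b) :
    β - (b - η) ^ (α - 1) / Real.Gamma α ≤ Kc α η β t s := by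
  have h1 := Kc_sub α η β η b s hα hα2 hb
  have h2 := Kc_anti α η β t b s hα h
  have : Kc α η β η s = β := by simp [Kc]
  linarith

theorem Kc_nonneg (α η β t s : ℝ) (hα : 1 < α) (hα2 : α ≤ 2) (hη : η ≤ 1)
    (hβ : (1 - η) ^ (α - 1) / Real.Gamma α ≤ β) (ht : t ≤ 1) : 0 ≤ Kc α η β t s := by
  have := Kc_lower α η β t 1 s hα hα2 hη ht
  linarith

theorem Kc_zero (α η β s : ℝ) (hα : 1 < α) (hη : 0 ≤ η) (hs : 0 ≤ s) :
    Kc α η β 0 s ≤ β + η ^ (α - 1) / Real.Gamma α := by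
  have hG := Real.Gamma_pos_of_pos (show (0:ℝ) < α by linarith)
  have := phi_mono (α - 1) (by linarith) (η - s) η (by linarith)
  rw [max_eq_left hη] at this
  have := div_le_div_of_nonneg_right this hG.le
  have h2 : 0 ≤ max (0 - s) 0 ^ (α - 1) / Real.Gamma α := by positivity
  simp only [Kc]; linarith

theorem Kc_sigma (α η β t b s σ : ℝ) (hα : 1 < α) (hα2 : α ≤ 2) (hη : 0 < η) (hβ0 : 0 < β)
    (hβ : (1 - η) ^ (α - 1) / Real.Gamma α ≤ β) (hb : η ≤ b) (hb1 : b ≤ 1) (ht : t ≤ b) (hs : 0 ≤ s)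
    (hσ : σ ≤ (β * Real.Gamma α - (b - η) ^ (α - 1)) / (β * Real.Gamma α + η ^ (α - 1))) :
    σ * Kc α η β 0 s ≤ Kc α η β t s := by
  have hG := Real.Gamma_pos_of_pos (show (0:ℝ) < α by linarith)
  have hK0 := Kc_nonneg α η β 0 s hα hα2 (by linarith) hβ zero_le_one
  have hK1 := Kc_zero α η β s hα hη.le hs
  have hl := Kc_lower α η β t b s hα hα2 hb ht
  have hηa : 0 < η ^ (α - 1) := Real.rpow_pos_of_pos hη _
  set c := (β * Real.Gamma α - (b - η) ^ (α - 1)) / (β * Real.Gamma α + η ^ (α - 1)) with hc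
  have hmono : (b - η) ^ (α - 1) ≤ (1 - η) ^ (α - 1) :=
    Real.rpow_le_rpow (by linarith) (by linarith) (by linarith)
  rw [div_le_iff₀ hG] at hβ
  have hc0 : 0 ≤ c := div_nonneg (by linarith) (by positivity)
  have he : c * (β + η ^ (α - 1) / Real.Gamma α) = β - (b - η) ^ (α - 1) / Real.Gamma α := by
    rw [hc]; field_simp
  calc σ * Kc α η β 0 s ≤ c * Kc α η β 0 s := mul_le_mul_of_nonneg_right hσ hK0
    _ ≤ c * (β + η ^ (α - 1) / Real.Gamma α) := mul_le_mul_of_nonneg_left hK1 hc0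
    _ ≤ _ := by rw [he]; exact hl

theorem gam_sigma (α η β t b σ : ℝ) (hα : 1 < α) (hα2 : α ≤ 2) (hη : 0 < η) (hβ0 : 0 < β)
    (ht : t ≤ b)
    (hσ : σ ≤ (β + (η - b) * Real.Gamma (3 - α)) / (β + η * Real.Gamma (3 - α))) :
    σ * gam α η β 0 ≤ gam α η β t := by
  have hG := Real.Gamma_pos_of_pos (show (0:ℝ) < 3 - α by linarith)
  have h0 : 0 ≤ gam α η β 0 := by
    have : 0 < β / Real.Gamma (3 - α) := by positivity
    simp only [gam]; linarith
  refine (mul_le_mul_of_nonneg_right hσ h0).trans ?_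
  have : (β + (η - b) * Real.Gamma (3 - α)) / (β + η * Real.Gamma (3 - α)) * gam α η β 0 = gam α η β b := by
    simp only [gam]; field_simp; ring
  rw [this]; simp only [gam]; linarith

theorem gam_nonneg (α η β t : ℝ) (hα2 : α ≤ 2)
    (hβ : (1 - η) * Real.Gamma (3 - α) ≤ β) (ht : t ≤ 1) : 0 ≤ gam α η β t := by
  have hG := Real.Gamma_pos_of_pos (show (0:ℝ) < 3 - α by linarith)
  rw [← le_div_iff₀ hG] at hβ
  simp only [gam]; linarith

/-- the candidate set -/
def candS (ρ b σ : ℝ) (ω : ℝ → ℝ) : Set (Set.Icc (0:ℝ) 1 → ℝ) :=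
  {v | v 0 = ρ ∧ (∀ t, 0 ≤ v t ∧ v t ≤ ρ) ∧
    (∀ t : Set.Icc (0:ℝ) 1, (t:ℝ) ≤ b → σ * ρ ≤ v t) ∧ ∀ x y, dist (v x) (v y) ≤ ω (dist x y)}

theorem candS_compact (ρ b σ : ℝ) (ω : ℝ → ℝ) (hω : Filter.Tendsto ω (nhds 0) (nhds 0)) :
    IsCompact {u : CI | (u : Set.Icc (0:ℝ) 1 → ℝ) ∈ candS ρ b σ ω} := by
  have heq : Equicontinuous ((↑) : candS ρ b σ ω → Set.Icc (0:ℝ) 1 → ℝ) :=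
    Metric.equicontinuous_of_continuity_modulus ω hω _ fun x y i => i.2.2.2.2 x y
  apply ArzelaAscoli.isCompact_of_equicontinuous
  · have : ContinuousMap.toFun '' {u : CI | (u : Set.Icc (0:ℝ) 1 → ℝ) ∈ candS ρ b σ ω} = candS ρ b σ ω := by
      ext v
      constructor
      · rintro ⟨u, hu, rfl⟩; exact hu
      · intro hv
        exact ⟨⟨v, heq.continuous ⟨v, hv⟩⟩, hv, rfl⟩
    rw [this]
    refine IsCompact.of_isClosed_subset (isCompact_univ_pi fun _ => isCompact_Icc (a := (0:ℝ)) (b := ρ)) ?_ ?_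
    · simp only [candS, ofPred_and, ofPred_forall]
      refine (isClosed_eq (by fun_prop) (by fun_prop)).inter (IsClosed.inter ?_ (IsClosed.inter ?_ ?_))
      · exact isClosed_iInter fun t => (isClosed_le (by fun_prop) (by fun_prop)).inter (isClosed_le (by fun_prop) (by fun_prop))
      · exact isClosed_iInter fun t => isClosed_iInter fun _ => isClosed_le (by fun_prop) (by fun_prop)
      · exact isClosed_iInter fun x => isClosed_iInter fun y => isClosed_le (by fun_prop) (by fun_prop)
    · intro v hv t _
      exact hv.2.1 t
  · exact Metric.equicontinuous_of_continuity_modulus ω hω _ fun x y i => i.2.2.2.2 x y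

theorem candS_convex (ρ b σ : ℝ) (ω : ℝ → ℝ) :
    Convex ℝ {u : CI | (u : Set.Icc (0:ℝ) 1 → ℝ) ∈ candS ρ b σ ω} := by
  intro u hu v hv p q hp hq hpq
  obtain ⟨u1, u2, u3, u4⟩ := hu
  obtain ⟨v1, v2, v3, v4⟩ := hv
  obtain rfl : q = 1 - p := by linarith
  refine ⟨?_, fun t => ⟨?_, ?_⟩, fun t ht => ?_, fun x y => ?_⟩
  · simp [u1, v1]; ring
  · have := (u2 t).1
    have := (v2 t).1
    simp; positivity
  · have := (u2 t).2
    have := (v2 t).2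
    simp; nlinarith
  · have := u3 t ht
    have := v3 t ht
    simp; nlinarith
  · have h1 := u4 x y
    have h2 := v4 x y
    rw [Real.dist_eq] at *
    simp only [ContinuousMap.add_apply, ContinuousMap.smul_apply, smul_eq_mul]
    rw [show p * u x + (1 - p) * v x - (p * u y + (1 - p) * v y) = p * (u x - u y) + (1 - p) * (v x - v y) by ring]
    refine (abs_add_le _ _).trans ?_
    rw [abs_mul, abs_mul, abs_of_nonneg hp, abs_of_nonneg hq]
    nlinarith

/-- Existence, Case 2: if `β = max{β_K, β_γ}`, `b ∈ [η,1)`,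
`f ≥ δ` on `[0,b]×[σ₂ρ,ρ]`, `H₁ ≥ η₁` and `H₂ ≥ η₂` on `P_{σ₂} ∩ ∂Ω_ρ`, and
`γ(0)η₁ + η₂ + ∫₀ᵇ K(0,s)δ(s) ds > 0`, then there exist `λ_ρ > 0` and `u_ρ` with
`‖u_ρ‖_∞ = ρ`, `u_ρ = λ_ρ·T(u_ρ)`, `u_ρ ≥ 0` on `[0,1]` and
`σ₂ρ ≤ u_ρ(t) ≤ ρ` on `[0,b]`. -/
theorem stmt_17
    (α η β : ℝ) (hα1 : 1 < α) (hα2 : α ≤ 2) (hη0 : 0 < η) (hη1 : η < 1) (hβ0 : 0 < β)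
    (f : ℝ → ℝ → ℝ)
    (hf : ContinuousOn (fun p : ℝ × ℝ => f p.1 p.2) (Set.Icc (0:ℝ) 1 ×ˢ Set.univ))
    (hf0 : ∀ t ∈ Set.Icc (0:ℝ) 1, ∀ x : ℝ, 0 ≤ f t x)
    (H₁ H₂ : CI → ℝ) (hH₁c : Continuous H₁) (hH₂c : Continuous H₂)
    (hH₁0 : ∀ u, 0 ≤ H₁ u) (hH₂0 : ∀ u, 0 ≤ H₂ u)
    (hH₁b : ∀ S : Set CI, Bornology.IsBounded S → Bornology.IsBounded (H₁ '' S))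
    (hH₂b : ∀ S : Set CI, Bornology.IsBounded S → Bornology.IsBounded (H₂ '' S))
    (T : CI → CI)
    (hT : ∀ (u : CI) (t : Set.Icc (0:ℝ) 1), T u t = H₁ u * gam α η β (t : ℝ) + H₂ u +
      ∫ s in (0:ℝ)..1, Kker α η β (t : ℝ) s * f s (Set.IccExtend zero_le_one u s))
    (hβ : β = max ((1 - η) ^ (α - 1) / Real.Gamma α) ((1 - η) * Real.Gamma (3 - α)))
    (b : ℝ) (hbl : η ≤ b) (hbu : b < 1)
    (ρ : ℝ) (hρ : 0 < ρ)
    (σ₂ : ℝ)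
    (hσ₂ : σ₂ = min ((β + (η - b) * Real.Gamma (3 - α)) / (β + η * Real.Gamma (3 - α)))
      (min ((β * Real.Gamma α - (b - η) ^ (α - 1)) / (β * Real.Gamma α + η ^ (α - 1))) 1))
    (δ : ℝ → ℝ) (hδc : ContinuousOn δ (Set.Icc (0:ℝ) b))
    (hδ0 : ∀ t ∈ Set.Icc (0:ℝ) b, 0 ≤ δ t)
    (hfδ : ∀ t ∈ Set.Icc (0:ℝ) b, ∀ x ∈ Set.Icc (σ₂ * ρ) ρ, δ t ≤ f t x)
    (η₁ η₂ : ℝ) (hη₁ : 0 ≤ η₁) (hη₂ : 0 ≤ η₂)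
    (hH : ∀ u : CI, (∀ t, 0 ≤ u t) →
      (∀ t : Set.Icc (0:ℝ) 1, (t : ℝ) ≤ b → σ₂ * ‖u‖ ≤ u t) → ‖u‖ = ρ →
      η₁ ≤ H₁ u ∧ η₂ ≤ H₂ u)
    (hpos : 0 < gam α η β 0 * η₁ + η₂ + ∫ s in (0:ℝ)..b, Kker α η β 0 s * δ s) :
    ∃ lam : ℝ, 0 < lam ∧ ∃ u : CI, ‖u‖ = ρ ∧ u = lam • T u ∧
      (∀ t, 0 ≤ u t) ∧
      ∀ t : Set.Icc (0:ℝ) 1, (t : ℝ) ≤ b → σ₂ * ρ ≤ u t ∧ u t ≤ ρ := by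
  have hβK : (1 - η) ^ (α - 1) / Real.Gamma α ≤ β := hβ ▸ le_max_left _ _
  have hβγ : (1 - η) * Real.Gamma (3 - α) ≤ β := hβ ▸ le_max_right _ _
  have hG := Real.Gamma_pos_of_pos (show (0:ℝ) < α by linarith)
  have hσγ : σ₂ ≤ (β + (η - b) * Real.Gamma (3 - α)) / (β + η * Real.Gamma (3 - α)) :=
    hσ₂ ▸ min_le_left _ _
  have hσK : σ₂ ≤ (β * Real.Gamma α - (b - η) ^ (α - 1)) / (β * Real.Gamma α + η ^ (α - 1)) :=
    hσ₂ ▸ (min_le_right _ _).trans (min_le_left _ _)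
  have hσ1 : σ₂ ≤ 1 := hσ₂ ▸ (min_le_right _ _).trans (min_le_right _ _)
  clear hσ₂ hβ
  -- the globally continuous Nemytskii term
  let J : CI → ℝ → ℝ := fun u s => f (projIcc 0 1 zero_le_one s) (u (projIcc 0 1 zero_le_one s))
  have hJc : Continuous fun p : CI × ℝ => J p.1 p.2 := by
    have h1 : Continuous fun p : CI × ℝ =>
        (((projIcc (0:ℝ) 1 zero_le_one p.2 : Set.Icc (0:ℝ) 1) : ℝ), p.1 (projIcc 0 1 zero_le_one p.2)) := by
      have h2 : Continuous fun p : CI × ℝ => projIcc (0:ℝ) 1 zero_le_one p.2 :=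
        continuous_projIcc.comp continuous_snd
      refine (continuous_subtype_val.comp h2).prodMk ?_
      exact continuous_fst.eval h2
    exact hf.comp_continuous h1 fun p => ⟨(projIcc (0:ℝ) 1 zero_le_one p.2).2, mem_univ _⟩
  have hJu : ∀ u, Continuous (J u) := fun u => hJc.comp (by fun_prop : Continuous fun s : ℝ => (u, s))
  have hJ0 : ∀ u s, 0 ≤ J u s := fun u s => hf0 _ (projIcc (0:ℝ) 1 zero_le_one s).2 _
  have hKs : ∀ t, Continuous fun s => Kc α η β t s := fun t =>
    (Kc_cont α η β hα1).comp (by fun_prop : Continuous fun s : ℝ => (t, s))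
  have hII : ∀ t u (x y : ℝ), IntervalIntegrable (fun s => Kc α η β t s * J u s) volume x y :=
    fun t u x y => ((hKs t).mul (hJu u)).intervalIntegrable _ _
  have hT' : ∀ (u : CI) (t : Set.Icc (0:ℝ) 1), T u t = H₁ u * gam α η β (t : ℝ) + H₂ u +
      ∫ s in (0:ℝ)..1, Kc α η β (t : ℝ) s * J u s := by
    intro u t
    rw [hT]
    congr 1
    refine intervalIntegral.integral_congr fun s hs => ?_
    rw [uIcc_of_le zero_le_one] at hs
    simp only [J]
    rw [Kker_eq _ _ _ _ _ hα1 hs.1, projIcc_of_mem zero_le_one hs, IccExtend_of_mem zero_le_one _ hs]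
  have hTc : Continuous T := by
    refine ContinuousMap.continuous_of_continuous_uncurry _ ?_
    have : (Function.uncurry fun (u : CI) (t : Set.Icc (0:ℝ) 1) => T u t) = fun p =>
        H₁ p.1 * gam α η β (p.2 : ℝ) + H₂ p.1 + ∫ s in (0:ℝ)..1, Kc α η β (p.2 : ℝ) s * J p.1 s := by
      ext p; exact hT' p.1 p.2
    rw [this]
    refine Continuous.add ?_ ?_
    · simp only [gam]; fun_prop
    · refine intervalIntegral.continuous_parametric_intervalIntegral_of_continuous' ?_ _ _
      refine Continuous.mul ?_ ?_
      · exact (Kc_cont α η β hα1).comp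
          (by fun_prop : Continuous fun q : (CI × Set.Icc (0:ℝ) 1) × ℝ => ((q.1.2 : ℝ), q.2))
      · exact hJc.comp (by fun_prop : Continuous fun q : (CI × Set.Icc (0:ℝ) 1) × ℝ => (q.1.1, q.2))
  -- pointwise facts on T
  have hK0 : ∀ t : Set.Icc (0:ℝ) 1, ∀ s, 0 ≤ Kc α η β t s := fun t s =>
    Kc_nonneg α η β t s hα1 hα2 hη1.le hβK t.2.2
  have hT0 : ∀ u t, 0 ≤ T u t := by
    intro u t
    rw [hT']
    have h1 := mul_nonneg (hH₁0 u) (gam_nonneg α η β t hα2 hβγ t.2.2)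
    have h2 := hH₂0 u
    have h3 : 0 ≤ ∫ s in (0:ℝ)..1, Kc α η β (t : ℝ) s * J u s :=
      intervalIntegral.integral_nonneg zero_le_one fun s _ => mul_nonneg (hK0 t s) (hJ0 u s)
    linarith
  have hTanti : ∀ u (t t' : Set.Icc (0:ℝ) 1), t ≤ t' → T u t' ≤ T u t := by
    intro u t t' htt
    have htt' : (t:ℝ) ≤ t' := htt
    rw [hT', hT']
    have h1 : H₁ u * gam α η β t' ≤ H₁ u * gam α η β t :=
      mul_le_mul_of_nonneg_left (by simp only [gam]; linarith) (hH₁0 u)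
    have h3 : (∫ s in (0:ℝ)..1, Kc α η β (t' : ℝ) s * J u s) ≤ ∫ s in (0:ℝ)..1, Kc α η β (t : ℝ) s * J u s :=
      intervalIntegral.integral_mono_on zero_le_one (hII _ _ _ _) (hII _ _ _ _) fun s _ =>
        mul_le_mul_of_nonneg_right (Kc_anti α η β t t' s hα1 htt') (hJ0 u s)
    linarith
  have hTσ : ∀ u (t : Set.Icc (0:ℝ) 1), (t:ℝ) ≤ b → σ₂ * T u 0 ≤ T u t := by
    intro u t htb
    rw [hT', hT', mul_add, mul_add]
    have h1 : σ₂ * (H₁ u * gam α η β ((0 : Set.Icc (0:ℝ) 1) : ℝ)) ≤ H₁ u * gam α η β t := by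
      have := mul_le_mul_of_nonneg_left (gam_sigma α η β t b σ₂ hα1 hα2 hη0 hβ0 htb hσγ) (hH₁0 u)
      simp only [Set.Icc.coe_zero]
      linarith
    have h2 : σ₂ * H₂ u ≤ H₂ u := by nlinarith [hH₂0 u]
    have h3 : σ₂ * (∫ s in (0:ℝ)..1, Kc α η β ((0 : Set.Icc (0:ℝ) 1) : ℝ) s * J u s) ≤
        ∫ s in (0:ℝ)..1, Kc α η β (t : ℝ) s * J u s := by
      rw [← intervalIntegral.integral_const_mul]
      refine intervalIntegral.integral_mono_on zero_le_one ((hII _ _ _ _).const_mul _) (hII _ _ _ _) fun s hs => ?_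
      rw [← mul_assoc]
      refine mul_le_mul_of_nonneg_right ?_ (hJ0 u s)
      exact Kc_sigma α η β t b s σ₂ hα1 hα2 hη0 hβ0 hβK hbl hbu.le htb hs.1 hσK
    linarith
  -- constants
  obtain ⟨M₁, hM₁⟩ := (hH₁b _ (Metric.isBounded_closedBall (x := (0:CI)) (r := ρ))).exists_norm_le
  obtain ⟨M₂, hM₂⟩ := (isCompact_Icc.prod isCompact_Icc :
    IsCompact (Set.Icc (0:ℝ) 1 ×ˢ Set.Icc (0:ℝ) ρ)).exists_bound_of_continuousOn
      (hf.mono (prod_mono_right (subset_univ _)))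
  set c₀ := gam α η β 0 * η₁ + η₂ + ∫ s in (0:ℝ)..b, Kker α η β 0 s * δ s with hc₀
  let ω : ℝ → ℝ := fun d => ρ / c₀ * (|M₁| * d + |M₂| * (d ^ (α - 1) / Real.Gamma α))
  have hω : Filter.Tendsto ω (nhds 0) (nhds 0) := by
    have : Continuous ω := by
      have := Real.continuous_rpow_const (q := α - 1) (by linarith)
      simp only [ω]; fun_prop
    have h := this.tendsto 0
    have h0 : ω 0 = 0 := by simp [ω, Real.zero_rpow (show α - 1 ≠ 0 by linarith)]
    rwa [h0] at h
  have hω0 : ∀ d, 0 ≤ d → 0 ≤ ω d := by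
    intro d hd
    have := Real.rpow_nonneg hd (α - 1)
    simp only [ω]; positivity
  let S : Set CI := {u : CI | (u : Set.Icc (0:ℝ) 1 → ℝ) ∈ candS ρ b σ₂ ω}
  have hSnorm : ∀ u ∈ S, ‖u‖ = ρ := by
    intro u hu
    apply le_antisymm
    · refine (ContinuousMap.norm_le _ hρ.le).2 fun t => ?_
      rw [Real.norm_of_nonneg (hu.2.1 t).1]
      exact (hu.2.1 t).2
    · have := u.norm_coe_le_norm 0
      rwa [hu.1, Real.norm_of_nonneg hρ.le] at this
  have hTlow : ∀ u ∈ S, c₀ ≤ T u 0 := by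
    intro u hu
    have hn := hSnorm u hu
    obtain ⟨hh1, hh2⟩ := hH u (fun t => (hu.2.1 t).1) (fun t ht => hn ▸ hu.2.2.1 t ht) hn
    rw [hT', hc₀]
    simp only [Set.Icc.coe_zero]
    have h1 : gam α η β 0 * η₁ ≤ H₁ u * gam α η β 0 := by
      rw [mul_comm]
      exact mul_le_mul_of_nonneg_right hh1 (gam_nonneg α η β 0 hα2 hβγ zero_le_one)
    have hb0 : 0 ≤ b := by linarith
    have hK0' : ∀ s, 0 ≤ Kc α η β 0 s := by simpa using hK0 0
    have h2 : (∫ s in (0:ℝ)..b, Kker α η β 0 s * δ s) = ∫ s in (0:ℝ)..b, Kc α η β 0 s * δ s := by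
      refine intervalIntegral.integral_congr fun s hs => ?_
      rw [uIcc_of_le hb0] at hs
      simp only [Kker_eq _ _ _ _ _ hα1 hs.1]
    have h3 : (∫ s in (0:ℝ)..b, Kc α η β 0 s * δ s) ≤ ∫ s in (0:ℝ)..b, Kc α η β 0 s * J u s := by
      refine intervalIntegral.integral_mono_on hb0 ?_ (hII _ _ _ _) fun s hs => ?_
      · refine ContinuousOn.intervalIntegrable ?_
        rw [uIcc_of_le hb0]
        exact (hKs 0).continuousOn.mul hδc
      · refine mul_le_mul_of_nonneg_left ?_ (hK0' s)
        have hs1 : s ∈ Set.Icc (0:ℝ) 1 := ⟨hs.1, hs.2.trans hbu.le⟩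
        simp only [J]
        rw [projIcc_of_mem zero_le_one hs1]
        exact hfδ s hs _ ⟨hu.2.2.1 ⟨s, hs1⟩ hs.2, (hu.2.1 ⟨s, hs1⟩).2⟩
    have h4 : 0 ≤ ∫ s in b..1, Kc α η β 0 s * J u s :=
      intervalIntegral.integral_nonneg hbu.le fun s _ => mul_nonneg (hK0' s) (hJ0 u s)
    have h5 := intervalIntegral.integral_add_adjacent_intervals (hII 0 u 0 b) (hII 0 u b 1)
    linarith
  have hTmod' : ∀ u ∈ S, ∀ x y : Set.Icc (0:ℝ) 1, x ≤ y →
      T u x - T u y ≤ |M₁| * dist x y + |M₂| * (dist x y ^ (α - 1) / Real.Gamma α) := by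
    intro u hu x y hxy
    have hxy' : (x:ℝ) ≤ y := hxy
    have hd : dist x y = y - x := by
      rw [Subtype.dist_eq, Real.dist_eq, abs_sub_comm, abs_of_nonneg (by linarith)]
    rw [hd, hT', hT']
    have hM1u : H₁ u ≤ |M₁| := by
      have := hM₁ (H₁ u) ⟨u, by simp [hSnorm u hu], rfl⟩
      exact (le_abs_self _).trans (this.trans (le_abs_self _))
    have h1 : H₁ u * gam α η β x - H₁ u * gam α η β y ≤ |M₁| * (y - x) := by
      rw [← mul_sub]
      have : gam α η β x - gam α η β y = y - x := by simp only [gam]; ring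
      rw [this]
      exact mul_le_mul_of_nonneg_right hM1u (by linarith)
    have h2 : (∫ s in (0:ℝ)..1, Kc α η β x s * J u s) - (∫ s in (0:ℝ)..1, Kc α η β y s * J u s) ≤
        |M₂| * ((y - x : ℝ) ^ (α - 1) / Real.Gamma α) := by
      rw [← intervalIntegral.integral_sub (hII _ _ _ _) (hII _ _ _ _)]
      have : (∫ s in (0:ℝ)..1, |M₂| * ((y - x : ℝ) ^ (α - 1) / Real.Gamma α)) =
        |M₂| * ((y - x : ℝ) ^ (α - 1) / Real.Gamma α) := by simp
      rw [← this]
      refine intervalIntegral.integral_mono_on zero_le_one ((hII _ _ _ _).sub (hII _ _ _ _)) (by simp) fun s _ => ?_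
      have hJM : J u s ≤ |M₂| := by
        have := hM₂ ((projIcc (0:ℝ) 1 zero_le_one s : Set.Icc (0:ℝ) 1), u (projIcc (0:ℝ) 1 zero_le_one s))
          ⟨(projIcc (0:ℝ) 1 zero_le_one s).2, hu.2.1 _⟩
        exact (le_abs_self _).trans (this.trans (le_abs_self _))
      have hk := Kc_sub α η β x y s hα1 hα2 hxy'
      have hr : 0 ≤ (y - x : ℝ) ^ (α - 1) / Real.Gamma α :=
        div_nonneg (Real.rpow_nonneg (by linarith) _) hG.le
      have hj := hJ0 u s
      rw [← sub_mul]
      calc (Kc α η β x s - Kc α η β y s) * J u s ≤ ((y - x : ℝ) ^ (α - 1) / Real.Gamma α) * J u s :=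
            mul_le_mul_of_nonneg_right (by linarith) hj
        _ ≤ ((y - x : ℝ) ^ (α - 1) / Real.Gamma α) * |M₂| := mul_le_mul_of_nonneg_left hJM hr
        _ = _ := mul_comm _ _
    linarith
  have hTmod : ∀ u ∈ S, ∀ x y : Set.Icc (0:ℝ) 1,
      |T u x - T u y| ≤ |M₁| * dist x y + |M₂| * (dist x y ^ (α - 1) / Real.Gamma α) := by
    intro u hu x y
    rcases le_total x y with h | h
    · rw [abs_of_nonneg (sub_nonneg.2 (hTanti u _ _ h))]
      exact hTmod' u hu x y h
    · rw [abs_sub_comm, dist_comm, abs_of_nonneg (sub_nonneg.2 (hTanti u _ _ h))]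
      exact hTmod' u hu y x h
  let F : CI → CI := fun u => (ρ / T u 0) • T u
  have hFc : ContinuousOn F S := by
    have h0 : Continuous fun u => T u 0 := (continuous_eval_const (F := CI) 0).comp hTc
    exact (continuousOn_const.div h0.continuousOn fun u hu => (hpos.trans_le (hTlow u hu)).ne').smul
      hTc.continuousOn
  have hFS : MapsTo F S S := by
    intro u hu
    have hlow := hTlow u hu
    have hp : 0 < T u 0 := hpos.trans_le hlow
    have hFa : ∀ t, F u t = ρ / T u 0 * T u t := fun t => rfl
    have hq : 0 < ρ / T u 0 := by positivity
    have hq0 : ρ / T u 0 * T u 0 = ρ := by field_simp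
    refine ⟨?_, fun t => ⟨?_, ?_⟩, fun t ht => ?_, fun x y => ?_⟩
    · rw [hFa, hq0]
    · rw [hFa]; exact mul_nonneg hq.le (hT0 u t)
    · rw [hFa]
      refine le_trans ?_ hq0.le
      exact mul_le_mul_of_nonneg_left (hTanti u 0 t t.2.1) hq.le
    · rw [hFa]
      have := mul_le_mul_of_nonneg_left (hTσ u t ht) hq.le
      nth_rewrite 1 [← hq0]
      linarith
    · rw [hFa, hFa, Real.dist_eq, ← mul_sub, abs_mul, abs_of_pos hq]
      have hd : (0:ℝ) ≤ dist x y ^ (α - 1) := Real.rpow_nonneg dist_nonneg _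
      refine mul_le_mul (div_le_div_of_nonneg_left hρ.le hpos hlow) (hTmod u hu x y) (abs_nonneg _) ?_
      positivity
  have hSne : S.Nonempty := by
    refine ⟨ContinuousMap.const _ ρ, rfl, fun t => ⟨hρ.le, le_rfl⟩, fun t _ => ?_, fun x y => ?_⟩
    · simp only [ContinuousMap.const_apply]; nlinarith
    · simpa using hω0 _ dist_nonneg
  obtain ⟨u, hu, hFu⟩ := schauder S (candS_compact ρ b σ₂ ω hω) (candS_convex ρ b σ₂ ω) hSne F hFc hFS
  exact ⟨ρ / T u 0, div_pos hρ (hpos.trans_le (hTlow u hu)), u, hSnorm u hu, hFu.symm,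
    fun t => (hu.2.1 t).1, fun t ht => ⟨hu.2.2.1 t ht, (hu.2.1 t).2⟩⟩
end
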